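/- arXiv:2510.05595 — 9 statements merged into one kernel-verified Lean document; each statement's English description precedes it below -/
import Mathlib

section
/- Let a and b be positive integers with a ∣ b. Let S = {x₁, …, xₙ} be a gcd-closed set of n distinct positive integers satisfying condition 𝒢 with max_{x∈S} |G_S(x)| = 3. Then the a-th power GCD matrix (S^a) divides the b-th power GCD matrix (S^b) in M_n(ℤ); in fact there exists an n × n integer matrix A such that (S^b) = A·(S^a). -/
open Finset

def gcdClosed (S : Finset ℕ) : Prop := ∀ x ∈ S, ∀ y ∈ S, Nat.gcd x y ∈ S

/-- The set of greatest-type divisors of `x` in `S`. -/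
def GTD (S : Finset ℕ) (x : ℕ) : Finset ℕ :=
  S.filter fun d => d < x ∧ d ∣ x ∧ ∀ y ∈ S, d ∣ y → y ∣ x → y = d ∨ y = x

/-- The element `x` satisfies condition 𝒢 with respect to `S`. -/
def condGAt (S : Finset ℕ) (x : ℕ) : Prop :=
  ∀ y₁ ∈ GTD S x, ∀ y₂ ∈ GTD S x, y₁ ≠ y₂ →
    Nat.lcm y₁ y₂ = x ∧ Nat.gcd y₁ y₂ ∈ GTD S y₁ ∧ Nat.gcd y₁ y₂ ∈ GTD S y₂

/-- The set `S` satisfies condition 𝒢. -/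
def condG (S : Finset ℕ) : Prop := ∀ x ∈ S, condGAt S x

/-- `c_{ij}`: the sum of `μ(d)` over positive integers `d` with `d·x_i ∣ x_j` and
`d·x_i ∤ x_t` for every `x_t ∈ S` with `x_t < x_j`. -/
def cMat {n : ℕ} (x : Fin n → ℕ) (i j : Fin n) : ℤ :=
  ∑ d ∈ (x j).divisors.filter
      (fun d => d * x i ∣ x j ∧ ∀ t : Fin n, x t < x j → ¬ d * x i ∣ x t),
    ArithmeticFunction.moebius d

/-- `α_{ξ_a}(x_k)`: the sum of `(ξ_a * μ)(d)` over divisors `d` of `x_k` with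
`d ∤ x_t` for every `x_t ∈ S` with `x_t < x_k`. -/
def alphaXi {n : ℕ} (a : ℕ) (x : Fin n → ℕ) (k : Fin n) : ℤ :=
  ∑ d ∈ (x k).divisors.filter (fun d => ∀ t : Fin n, x t < x k → ¬ d ∣ x t),
    ∑ e ∈ d.divisors, (e : ℤ) ^ a * ArithmeticFunction.moebius (d / e)

/-- `α_{1/ξ_a}(x_k)`: the sum of `((1/ξ_a) * μ)(d)` over divisors `d` of `x_k` with
`d ∤ x_t` for every `x_t ∈ S` with `x_t < x_k`. -/
def alphaInvXi {n : ℕ} (a : ℕ) (x : Fin n → ℕ) (k : Fin n) : ℚ :=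
  ∑ d ∈ (x k).divisors.filter (fun d => ∀ t : Fin n, x t < x k → ¬ d ∣ x t),
    ∑ e ∈ d.divisors, ((e : ℚ) ^ a)⁻¹ * ((ArithmeticFunction.moebius (d / e) : ℤ) : ℚ)

/-- The Möbius inverse of `f` with respect to divisibility in `S`. -/
def gcdMoebius (S : Finset ℕ) (f : ℕ → ℤ) (x : ℕ) : ℤ :=
  f x - ∑ d ∈ (S.filter fun d => d < x ∧ d ∣ x).attach, gcdMoebius S f d
termination_by x
decreasing_by exact (Finset.mem_filter.mp d.2).2.1

theorem sum_gcdMoebius {S : Finset ℕ} (f : ℕ → ℤ) {x : ℕ} (hx : x ∈ S) (h0 : 0 < x) :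
    ∑ d ∈ S with d ∣ x, gcdMoebius S f d = f x := by
  have hS : S.filter (fun d => d ∣ x) = insert x (S.filter fun d => d < x ∧ d ∣ x) := by
    ext d
    simp only [mem_filter, mem_insert]
    constructor
    · rintro ⟨hd, hdx⟩
      rcases (Nat.le_of_dvd h0 hdx).lt_or_eq with h | h
      · exact Or.inr ⟨hd, h, hdx⟩
      · exact Or.inl h
    · rintro (rfl | ⟨hd, -, hdx⟩)
      · exact ⟨hx, dvd_rfl⟩
      · exact ⟨hd, hdx⟩
  rw [hS, sum_insert (by simp), gcdMoebius,
    Finset.sum_attach (S.filter fun d => d < x ∧ d ∣ x) (gcdMoebius S f)]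
  ring

theorem exists_dvd_mem_GTD {S : Finset ℕ} {x d : ℕ} (h0 : 0 < x) (hd : d ∈ S) (hdx : d ∣ x)
    (hne : d ≠ x) : ∃ y ∈ GTD S x, d ∣ y := by
  obtain ⟨y, hy, hmax⟩ := (S.filter fun y => d ∣ y ∧ y ∣ x ∧ y < x).exists_max_image id
    ⟨d, by simp [hd, hdx, (Nat.le_of_dvd h0 hdx).lt_of_ne hne]⟩
  simp only [mem_filter, id] at hy hmax
  obtain ⟨hyS, hdy, hyx, hlt⟩ := hy
  refine ⟨y, by
    simp only [GTD, mem_filter]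
    refine ⟨hyS, hlt, hyx, fun z hz hyz hzx => ?_⟩
    rcases (Nat.le_of_dvd h0 hzx).lt_or_eq with h | h
    · exact Or.inl <| (hmax z ⟨hz, hdy.trans hyz, hzx, h⟩).antisymm
        (Nat.le_of_dvd (Nat.pos_of_dvd_of_pos hzx h0) hyz)
    · exact Or.inr h, hdy⟩

theorem coprime_div_of_lcm_eq {x y z : ℕ} (h0 : 0 < x) (hy : y ∣ x) (hz : z ∣ x)
    (h : Nat.lcm y z = x) : Nat.Coprime (x / y) (x / z) := by
  have hk : Nat.lcm (y * Nat.gcd (x / y) (x / z)) (z * Nat.gcd (x / y) (x / z)) ∣ x :=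
    Nat.lcm_dvd
      ((mul_dvd_mul_left y (Nat.gcd_dvd_left _ _)).trans (Nat.mul_div_cancel' hy).dvd)
      ((mul_dvd_mul_left z (Nat.gcd_dvd_right _ _)).trans (Nat.mul_div_cancel' hz).dvd)
  rw [Nat.lcm_mul_right, h] at hk
  exact Nat.dvd_one.mp (Nat.dvd_of_mul_dvd_mul_left h0 (by simpa using hk))

theorem exists_mul_prod_div_eq {S : Finset ℕ} (hS : gcdClosed S) {x : ℕ} (hx : x ∈ S)
    (h0 : 0 < x) (hG : condGAt S x) {T : Finset ℕ} (hT : T ⊆ GTD S x) :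
    ∃ q ∈ S, x = q * ∏ y ∈ T, x / y ∧ ∀ d, d ∣ q ↔ d ∣ x ∧ ∀ y ∈ T, d ∣ y := by
  induction T using Finset.induction_on with
  | empty => exact ⟨x, hx, by simp, by simp⟩
  | insert y T hyT ih =>
    obtain ⟨hy, hT⟩ := insert_subset_iff.mp hT
    obtain ⟨q, hq, hxq, hdq⟩ := ih hT
    have hyx : y ∣ x := (mem_filter.mp hy).2.2.1
    have hcop : Nat.Coprime (x / y) (∏ z ∈ T, x / z) := by
      refine Nat.Coprime.prod_right fun z hz => ?_
      exact coprime_div_of_lcm_eq h0 hyx (mem_filter.mp (hT hz)).2.2.1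
        (hG y hy z (hT hz) (ne_of_mem_of_not_mem hz hyT).symm).1
    obtain ⟨r, rfl⟩ : x / y ∣ q :=
      hcop.dvd_of_dvd_mul_right (hxq ▸ Nat.div_dvd_of_dvd hyx)
    have hm : 0 < x / y := Nat.div_pos (Nat.le_of_dvd h0 hyx) (Nat.pos_of_dvd_of_pos hyx h0)
    have hyr : y = (∏ z ∈ T, x / z) * r := by
      apply Nat.eq_of_mul_eq_mul_left hm
      rw [Nat.div_mul_cancel hyx]
      conv_lhs => rw [hxq]
      ring
    have hgcd : Nat.gcd (x / y * r) ((∏ z ∈ T, x / z) * r) = r := by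
      rw [Nat.gcd_mul_right, hcop.gcd_eq_one, one_mul]
    rw [← hyr] at hgcd
    refine ⟨r, hgcd ▸ hS _ hq _ (mem_filter.mp hy).1, ?_, fun d => ?_⟩
    · rw [prod_insert hyT]
      conv_lhs => rw [hxq]
      ring
    · conv_lhs => rw [← hgcd]
      rw [Nat.dvd_gcd_iff, hdq, forall_mem_insert]
      tauto

theorem gcdMoebius_eq_sum_powerset {S : Finset ℕ} (f : ℕ → ℤ) {x : ℕ} (hx : x ∈ S)
    (h0 : 0 < x) :
    gcdMoebius S f x = ∑ T ∈ (GTD S x).powerset,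
      (-1) ^ #T * ∑ d ∈ S with d ∣ x ∧ ∀ y ∈ T, d ∣ y, gcdMoebius S f d := by
  have hprod (d : ℕ) : ∏ y ∈ GTD S x, (1 - if d ∣ y then (1 : ℤ) else 0)
      = ∑ T ∈ (GTD S x).powerset, (-1) ^ #T * if ∀ y ∈ T, d ∣ y then 1 else 0 := by
    rw [prod_sub]
    simp [Finset.prod_ite_zero]
  calc gcdMoebius S f x
      = ∑ d ∈ S with d ∣ x,
          gcdMoebius S f d * ∏ y ∈ GTD S x, (1 - if d ∣ y then (1 : ℤ) else 0) := by
        rw [Finset.sum_eq_single x]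
        · rw [prod_eq_one, mul_one]
          intro y hy
          have hlt := (mem_filter.mp hy).2.1
          have hyx := (mem_filter.mp hy).2.2.1
          rw [if_neg fun h => (Nat.le_of_dvd (Nat.pos_of_dvd_of_pos hyx h0) h).not_gt hlt,
            sub_zero]
        · intro d hd hne
          obtain ⟨hdS, hdx⟩ := mem_filter.mp hd
          obtain ⟨y, hy, hdy⟩ := exists_dvd_mem_GTD h0 hdS hdx hne
          rw [prod_eq_zero hy (by simp [hdy]), mul_zero]
        · simp [hx]
    _ = _ := by
        simp_rw [hprod, mul_sum]
        rw [sum_comm]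
        refine sum_congr rfl fun T _ => ?_
        rw [← filter_filter, sum_filter (fun d => ∀ y ∈ T, d ∣ y)]
        refine sum_congr rfl fun d _ => ?_
        split_ifs <;> ring

theorem exists_gcdMoebius_pow_eq {S : Finset ℕ} (hS : gcdClosed S) {x : ℕ} (hx : x ∈ S)
    (h0 : 0 < x) (hG : condGAt S x) :
    ∃ w : ℕ, ∀ a : ℕ, gcdMoebius S (fun m => (m : ℤ) ^ a) x
      = (w : ℤ) ^ a * ∏ y ∈ GTD S x, (((x / y : ℕ) : ℤ) ^ a - 1) := by
  obtain ⟨w, -, hw, -⟩ := exists_mul_prod_div_eq hS hx h0 hG (Subset.refl _)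
  refine ⟨w, fun a => ?_⟩
  rw [gcdMoebius_eq_sum_powerset _ hx h0, prod_sub, mul_sum]
  refine sum_congr rfl fun T hT => ?_
  rw [mem_powerset] at hT
  obtain ⟨q, hq, hxq, hdq⟩ := exists_mul_prod_div_eq hS hx h0 hG hT
  simp_rw [← hdq]
  have hqx : q ∣ x := ⟨_, hxq⟩
  have hP : 0 < ∏ y ∈ T, x / y := Nat.pos_of_mul_pos_left (hxq ▸ h0)
  rw [sum_gcdMoebius _ hq (Nat.pos_of_dvd_of_pos hqx h0)]
  have hqw : q = w * ∏ y ∈ GTD S x \ T, x / y := by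
    apply Nat.eq_of_mul_eq_mul_right hP
    rw [← hxq, mul_assoc, prod_sdiff hT, ← hw]
  rw [hqw]
  push_cast
  rw [mul_pow, prod_pow]
  simp
  ring

theorem gcdMoebius_pow_dvd {S : Finset ℕ} (hS : gcdClosed S) {x : ℕ} (hx : x ∈ S)
    (h0 : 0 < x) (hG : condGAt S x) {a b : ℕ} (hb : 0 < b) (hab : a ∣ b) :
    gcdMoebius S (fun m => (m : ℤ) ^ a) x ∣ gcdMoebius S (fun m => (m : ℤ) ^ b) x := by
  obtain ⟨w, hw⟩ := exists_gcdMoebius_pow_eq hS hx h0 hG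
  rw [hw, hw]
  refine mul_dvd_mul (pow_dvd_pow _ (Nat.le_of_dvd hb hab)) (prod_dvd_prod_of_dvd _ _ fun y _ => ?_)
  obtain ⟨c, rfl⟩ := hab
  rw [pow_mul]
  exact sub_one_dvd_pow_sub_one _ _

/-- The divisibility incidence matrix of `x`. -/
def dvdMatrix {n : ℕ} (x : Fin n → ℕ) : Matrix (Fin n) (Fin n) ℤ :=
  Matrix.of fun i j => if x j ∣ x i then 1 else 0

theorem det_dvdMatrix {n : ℕ} {x : Fin n → ℕ} (hpos : ∀ i, 0 < x i) (hmono : StrictMono x) :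
    (dvdMatrix x).det = 1 := by
  rw [Matrix.det_of_isLowerTriangular]
  · simp [dvdMatrix]
  · intro i j hij
    have hij : i < j := hij
    simp only [dvdMatrix, Matrix.of_apply, ite_eq_right_iff, one_ne_zero, imp_false]
    exact fun h => (Nat.le_of_dvd (hpos i) h).not_gt (hmono hij)

theorem gcdMatrix_eq_mul {n : ℕ} {x : Fin n → ℕ} (hpos : ∀ i, 0 < x i) (hmono : StrictMono x)
    (hgcd : gcdClosed (univ.image x)) (f : ℕ → ℤ) :
    (Matrix.of fun i j => f (Nat.gcd (x i) (x j)))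
      = dvdMatrix x * Matrix.diagonal (fun k => gcdMoebius (univ.image x) f (x k))
        * (dvdMatrix x).transpose := by
  ext i j
  rw [Matrix.mul_apply]
  simp only [Matrix.mul_diagonal, Matrix.transpose_apply, dvdMatrix, Matrix.of_apply]
  rw [← sum_gcdMoebius f (hgcd _ (mem_image_of_mem x (mem_univ i)) _
    (mem_image_of_mem x (mem_univ j))) (Nat.gcd_pos_of_pos_left _ (hpos i)), sum_filter,
    sum_image hmono.injective.injOn]
  refine sum_congr rfl fun k _ => ?_
  by_cases h₁ : x k ∣ x i <;> by_cases h₂ : x k ∣ x j <;> simp [Nat.dvd_gcd_iff, h₁, h₂]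


theorem power_gcd_divides_power_gcd
    (n a b : ℕ) (ha : 0 < a) (hb : 0 < b) (hab : a ∣ b)
    (x : Fin n → ℕ) (hpos : ∀ i, 0 < x i) (hmono : StrictMono x)
    (hgcd : gcdClosed (Finset.image x Finset.univ))
    (hG : condG (Finset.image x Finset.univ))
    (hmax : (∀ i, (GTD (Finset.image x Finset.univ) (x i)).card ≤ 3) ∧
            (∃ i, (GTD (Finset.image x Finset.univ) (x i)).card = 3)) :
    ∃ A : Matrix (Fin n) (Fin n) ℤ,
      (Matrix.of fun i j => (Nat.gcd (x i) (x j) : ℤ) ^ b)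
        = A * (Matrix.of fun i j => (Nat.gcd (x i) (x j) : ℤ) ^ a) := by
  have hdvd (i : Fin n) := gcdMoebius_pow_dvd hgcd (mem_image_of_mem x (mem_univ i)) (hpos i)
    (hG _ (mem_image_of_mem x (mem_univ i))) hb hab
  choose c hc using hdvd
  refine ⟨dvdMatrix x * Matrix.diagonal c * (dvdMatrix x)⁻¹, ?_⟩
  have hunit : IsUnit (dvdMatrix x).det := by simp [det_dvdMatrix hpos hmono]
  rw [gcdMatrix_eq_mul hpos hmono hgcd fun m => (m : ℤ) ^ b,
    gcdMatrix_eq_mul hpos hmono hgcd fun m => (m : ℤ) ^ a]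
  simp only [Matrix.mul_assoc]
  rw [Matrix.nonsing_inv_mul_cancel_left _ _ hunit, ← Matrix.mul_assoc (Matrix.diagonal c),
    Matrix.diagonal_mul_diagonal]
  simp only [hc, mul_comm]
end

section
/- Let a and b be positive integers with a ∣ b. Let S = {x₁, …, xₙ} be a gcd-closed set of n distinct positive integers satisfying condition 𝒢 with max_{x∈S} |G_S(x)| = 3. Then the a-th power GCD matrix (S^a) divides the b-th power LCM matrix [S^b] in M_n(ℤ); in fact there exists an n × n integer matrix A such that [S^b] = A·(S^a). -/
open Finset

/-- The quotients `v / y` for `y` a greatest-type divisor of `v` in `S`. -/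
def cofactors (S : Finset ℕ) (v : ℕ) : Finset ℕ :=
  v.divisors.filter fun d => v / d ∈ GTD S v

/-- The alternating sum of `f (v / ∏ T)` over the subsets `T` of `D`. -/
def altSum (f : ℕ → ℤ) (v : ℕ) (D : Finset ℕ) : ℤ :=
  ∑ T ∈ D.powerset, (-1) ^ T.card * f (v / ∏ d ∈ T, d)

theorem altSum_insert (f : ℕ → ℤ) (v d : ℕ) {D : Finset ℕ} (hd : d ∉ D) :
    altSum f v (insert d D) = altSum f v D - altSum f (v / d) D := by
  unfold altSum
  rw [Finset.sum_powerset_insert hd, sub_eq_add_neg, ← Finset.sum_neg_distrib]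
  congr 1
  refine Finset.sum_congr rfl fun T hT => ?_
  have hdT : d ∉ T := fun h => hd (Finset.mem_powerset.1 hT h)
  rw [Finset.card_insert_of_notMem hdT, Finset.prod_insert hdT, Nat.div_div_eq_div_mul]
  ring

theorem mem_cofactors {S : Finset ℕ} {v d : ℕ} (hv : v ≠ 0) :
    d ∈ cofactors S v ↔ d ∣ v ∧ v / d ∈ GTD S v := by
  simp [cofactors, hv]

theorem mem_of_mem_GTD {S : Finset ℕ} {v y : ℕ} (h : y ∈ GTD S v) : y ∈ S :=
  (Finset.mem_filter.1 h).1

theorem exists_mem_GTD {S : Finset ℕ} (h0 : 0 ∉ S) {v h : ℕ} (hv : v ∈ S) (hh : h ∈ S)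
    (hdvd : h ∣ v) (hne : h ≠ v) : ∃ y ∈ GTD S v, h ∣ y := by
  have hv0 : 0 < v := Nat.pos_of_ne_zero fun e => h0 (e ▸ hv)
  obtain ⟨y, hy, hmax⟩ := Finset.exists_max_image
    (S.filter fun y => h ∣ y ∧ y ∣ v ∧ y ≠ v) id ⟨h, by simp [hh, hdvd, hne]⟩
  simp only [Finset.mem_filter, id] at hy hmax
  obtain ⟨hyS, hhy, hyv, hyne⟩ := hy
  refine ⟨y, Finset.mem_filter.2 ⟨hyS, lt_of_le_of_ne (Nat.le_of_dvd hv0 hyv) hyne, hyv, ?_⟩, hhy⟩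
  intro w hw hyw hwv
  by_cases hwv' : w = v
  · exact Or.inr hwv'
  · have hw0 : 0 < w := Nat.pos_of_ne_zero fun e => h0 (e ▸ hw)
    exact Or.inl (le_antisymm (hmax w ⟨hw, hhy.trans hyw, hwv, hwv'⟩) (Nat.le_of_dvd hw0 hyw))

theorem cofactors_pair {S : Finset ℕ} (h0 : 0 ∉ S) (hG : condG S) {v d e : ℕ} (hv : v ∈ S)
    (hd : d ∈ cofactors S v) (he : e ∈ cofactors S v) (hde : d ≠ e) :
    Nat.Coprime d e ∧ e ∈ cofactors S (v / d) := by
  have hv0 : v ≠ 0 := fun h => h0 (h ▸ hv)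
  obtain ⟨⟨y₁, h₁⟩, hy₁⟩ := (mem_cofactors hv0).1 hd
  obtain ⟨⟨y₂, h₂⟩, hy₂⟩ := (mem_cofactors hv0).1 he
  have hd0 : 0 < d := Nat.pos_of_ne_zero fun h => hv0 (by simp [h₁, h])
  have he0 : 0 < e := Nat.pos_of_ne_zero fun h => hv0 (by simp [h₂, h])
  have e₁ : v / d = y₁ := by rw [h₁, Nat.mul_div_cancel_left _ hd0]
  have e₂ : v / e = y₂ := by rw [h₂, Nat.mul_div_cancel_left _ he0]
  rw [e₁] at hy₁ ⊢
  rw [e₂] at hy₂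
  have hy₁0 : y₁ ≠ 0 := fun h => hv0 (by simp [h₁, h])
  have hne : y₁ ≠ y₂ := by
    rintro rfl
    exact hde (Nat.eq_of_mul_eq_mul_right (Nat.pos_of_ne_zero hy₁0) (h₁.symm.trans h₂))
  obtain ⟨hlcm, hgcd, -⟩ := hG v hv y₁ hy₁ y₂ hy₂ hne
  have hcop : Nat.Coprime d e := by
    obtain ⟨d', hd'⟩ := Nat.gcd_dvd_left d e
    obtain ⟨e', he'⟩ := Nat.gcd_dvd_right d e
    have hk : 0 < Nat.gcd d e := Nat.gcd_pos_of_pos_left _ hd0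
    set k := Nat.gcd d e with hkdef
    have hv₁ : v = k * (d' * y₁) := by rw [← mul_assoc, ← hd', h₁]
    have hv₂ : v = k * (e' * y₂) := by rw [← mul_assoc, ← he', h₂]
    have heq : d' * y₁ = e' * y₂ := Nat.eq_of_mul_eq_mul_left hk (hv₁.symm.trans hv₂)
    have hdv : v ∣ d' * y₁ := by
      rw [← hlcm]
      exact Nat.lcm_dvd (Dvd.intro_left _ rfl) (heq ▸ Dvd.intro_left _ rfl)
    have hpos : 0 < d' * y₁ := Nat.pos_of_ne_zero fun h => hv0 (by rw [hv₁, h, mul_zero])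
    have hle := Nat.le_of_dvd hpos hdv
    have : k ≤ 1 := by
      by_contra! hk1
      nlinarith
    show k = 1
    omega
  refine ⟨hcop, (mem_cofactors hy₁0).2 ?_⟩
  have hey : e ∣ y₁ := hcop.symm.dvd_of_dvd_mul_left (h₁ ▸ ⟨y₂, h₂⟩)
  obtain ⟨m, rfl⟩ := hey
  have hy₂m : y₂ = d * m := Nat.eq_of_mul_eq_mul_left he0 (by rw [← h₂, h₁]; ring)
  refine ⟨Dvd.intro _ rfl, ?_⟩
  rw [hy₂m, Nat.gcd_mul_right, hcop.symm.gcd_eq_one, one_mul] at hgcd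
  rwa [Nat.mul_div_cancel_left _ he0]

theorem div_mem_of_mem_cofactors {S : Finset ℕ} (h0 : 0 ∉ S) {v d : ℕ}
    (hv : v ∈ S) (hd : d ∈ cofactors S v) :
    v / d ∈ S :=
  mem_of_mem_GTD ((mem_cofactors fun h => h0 (h ▸ hv)).1 hd).2

theorem subset_cofactors_div {S : Finset ℕ} (h0 : 0 ∉ S) (hG : condG S)
    {v d : ℕ} (hv : v ∈ S) {D : Finset ℕ} (hdD : d ∉ D)
    (hd : d ∈ cofactors S v) (hD : D ⊆ cofactors S v) : D ⊆ cofactors S (v / d) :=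
  fun _ he => (cofactors_pair h0 hG hv hd (hD he) fun h => hdD (h ▸ he)).2

theorem prod_dvd_of_subset_cofactors {S : Finset ℕ} (h0 : 0 ∉ S) (hG : condG S)
    {v : ℕ} (hv : v ∈ S) {D : Finset ℕ}
    (hD : D ⊆ cofactors S v) : ∏ d ∈ D, d ∣ v := by
  refine Finset.prod_dvd_of_isRelPrime (fun d hd e he hde => ?_) fun d hd => ?_
  · exact Nat.coprime_iff_isRelPrime.1 (cofactors_pair h0 hG hv (hD hd) (hD he) hde).1
  · exact ((mem_cofactors fun h => h0 (h ▸ hv)).1 (hD hd)).1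

theorem altSum_pow {S : Finset ℕ} (h0 : 0 ∉ S) (hG : condG S)
    (a : ℕ) {D : Finset ℕ} {v : ℕ} (hv : v ∈ S) (hD : D ⊆ cofactors S v) :
    altSum (fun w => (w : ℤ) ^ a) v D =
      ((v / ∏ d ∈ D, d : ℕ) : ℤ) ^ a * ∏ d ∈ D, ((d : ℤ) ^ a - 1) := by
  induction D using Finset.induction_on generalizing v with
  | empty => simp [altSum]
  | insert d D hd ih =>
    have hdv := hD (Finset.mem_insert_self d D)
    have hD' : D ⊆ cofactors S v := (Finset.subset_insert d D).trans hD
    rw [altSum_insert _ _ _ hd, ih hv hD', ih (div_mem_of_mem_cofactors h0 hv hdv)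
      (subset_cofactors_div h0 hG hv hd hdv hD'), Finset.prod_insert hd, Finset.prod_insert hd,
      Nat.div_div_eq_div_mul]
    obtain ⟨m, hm⟩ := prod_dvd_of_subset_cofactors h0 hG hv hD
    rw [Finset.prod_insert hd] at hm
    have hv0 : v ≠ 0 := fun h => h0 (h ▸ hv)
    have hP : 0 < d * ∏ e ∈ D, e := Nat.pos_of_ne_zero fun h => hv0 (by rw [hm, h, zero_mul])
    have h₁ : v / (d * ∏ e ∈ D, e) = m := by rw [hm, Nat.mul_div_cancel_left _ hP]
    have h₂ : v / ∏ e ∈ D, e = d * m := by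
      rw [hm, mul_comm d, mul_assoc, Nat.mul_div_cancel_left _ (Nat.pos_of_mul_pos_left hP)]
    rw [h₁, h₂]
    push_cast
    ring

theorem altSum_eq_sum {S : Finset ℕ} (h0 : 0 ∉ S) (hG : condG S)
    (f g : ℕ → ℤ) (hfg : ∀ v ∈ S, ∑ w ∈ S with w ∣ v, g w = f v)
    {D : Finset ℕ} {v : ℕ} (hv : v ∈ S) (hD : D ⊆ cofactors S v) :
    altSum f v D = ∑ w ∈ S with w ∣ v ∧ ∀ d ∈ D, ¬ w ∣ v / d, g w := by
  induction D using Finset.induction_on generalizing v with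
  | empty => simp [altSum, hfg v hv]
  | insert d D hd ih =>
    have hdv := hD (Finset.mem_insert_self d D)
    have hD' : D ⊆ cofactors S v := (Finset.subset_insert d D).trans hD
    have hv0 : v ≠ 0 := fun h => h0 (h ▸ hv)
    have hd_dvd := ((mem_cofactors hv0).1 hdv).1
    rw [altSum_insert _ _ _ hd, ih hv hD', ih (div_mem_of_mem_cofactors h0 hv hdv)
      (subset_cofactors_div h0 hG hv hd hdv hD'), sub_eq_iff_eq_add]
    rw [← Finset.sum_filter_add_sum_filter_not _ (fun w => ¬ w ∣ v / d),
      Finset.filter_filter, Finset.filter_filter]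
    congr 1
    · refine Finset.sum_congr (Finset.filter_congr fun w _ => ?_) fun _ _ => rfl
      simp only [Finset.forall_mem_insert]
      tauto
    · refine Finset.sum_congr (Finset.filter_congr fun w _ => ?_) fun _ _ => rfl
      have key : w ∣ v / d → ∀ e ∈ D, (w ∣ v / e ↔ w ∣ v / d / e) := by
        intro hw e he
        have hev := hD' he
        obtain ⟨hcop, hev'⟩ := cofactors_pair h0 hG hv hdv hev fun h => hd (h ▸ he)
        obtain ⟨m, hm⟩ := hcop.mul_dvd_of_dvd_of_dvd hd_dvd ((mem_cofactors hv0).1 hev).1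
        have hd0 : 0 < d := Nat.pos_of_ne_zero fun h => hv0 (by simp [hm, h])
        have he0 : 0 < e := Nat.pos_of_ne_zero fun h => hv0 (by simp [hm, h])
        have h₁ : v / d = e * m := by rw [hm, mul_assoc, Nat.mul_div_cancel_left _ hd0]
        have h₂ : v / e = d * m := by
          rw [hm, mul_comm d, mul_assoc, Nat.mul_div_cancel_left _ he0]
        rw [h₁] at hw
        rw [h₁, h₂, Nat.mul_div_cancel_left _ he0]
        refine ⟨fun h => ?_, fun h => h.mul_left d⟩
        have := Nat.dvd_gcd h hw
        rwa [Nat.gcd_mul_right, hcop.gcd_eq_one, one_mul] at this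
      constructor
      · rintro ⟨⟨-, hall⟩, hw⟩
        rw [not_not] at hw
        exact ⟨hw, fun e he => (key hw e he).not.1 (hall e he)⟩
      · rintro ⟨hw, hall⟩
        exact ⟨⟨hw.trans (Nat.div_dvd_of_dvd hd_dvd),
          fun e he => (key hw e he).not.2 (hall e he)⟩, not_not.2 hw⟩

theorem altSum_cofactors {S : Finset ℕ} (h0 : 0 ∉ S) (hG : condG S)
    (f g : ℕ → ℤ) (hfg : ∀ v ∈ S, ∑ w ∈ S with w ∣ v, g w = f v)
    {v : ℕ} (hv : v ∈ S) : altSum f v (cofactors S v) = g v := by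
  have hv0 : v ≠ 0 := fun h => h0 (h ▸ hv)
  rw [altSum_eq_sum h0 hG f g hfg hv (Finset.Subset.refl _)]
  have : (S.filter fun w => w ∣ v ∧ ∀ d ∈ cofactors S v, ¬ w ∣ v / d) = {v} := by
    ext w
    simp only [Finset.mem_filter, Finset.mem_singleton]
    constructor
    · rintro ⟨hw, hwv, hall⟩
      by_contra hne
      obtain ⟨y, hy, hwy⟩ := exists_mem_GTD h0 hv hw hwv hne
      have hyv : y ∣ v := (Finset.mem_filter.1 hy).2.2.1
      have hdd : v / (v / y) = y := Nat.div_div_self hyv hv0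
      exact hall (v / y)
        ((mem_cofactors hv0).2 ⟨Nat.div_dvd_of_dvd hyv, by rwa [hdd]⟩) (by rwa [hdd])
    · rintro rfl
      refine ⟨hv, dvd_rfl, fun d hd h => ?_⟩
      have hmem := (Finset.mem_filter.1 ((mem_cofactors hv0).1 hd).2)
      exact absurd (Nat.le_of_dvd (Nat.pos_of_ne_zero fun e => h0 (e ▸ hmem.1)) h)
        (not_le.2 hmem.2.1)
  rw [this, Finset.sum_singleton]

theorem lcm_mul_of_gcd_dvd {z c d m : ℕ} (hc : Nat.Coprime c d)
    (h : Nat.gcd z (d * c * m) ∣ c * m) : Nat.lcm z (d * m) = d * Nat.lcm z m := by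
  have hg : Nat.gcd z (d * m) = Nat.gcd z m := by
    refine Nat.dvd_antisymm (Nat.dvd_gcd (Nat.gcd_dvd_left _ _) ?_)
      (Nat.gcd_dvd_gcd_of_dvd_right _ (Dvd.intro_left _ rfl))
    have h₁ : Nat.gcd z (d * m) ∣ c * m :=
      (Nat.gcd_dvd_gcd_of_dvd_right _ ⟨c, by ring⟩).trans h
    have := Nat.dvd_gcd h₁ (Nat.gcd_dvd_right z (d * m))
    rwa [Nat.gcd_mul_right, hc.gcd_eq_one, one_mul] at this
  rw [Nat.lcm, Nat.lcm, hg, ← Nat.mul_div_assoc _ ((Nat.gcd_dvd_left z m).mul_right m)]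
  congr 1
  ring

theorem dvd_altSum_lcm {S : Finset ℕ} (h0 : 0 ∉ S) (hG : condG S) (hS : gcdClosed S)
    {a b : ℕ} (hb : 0 < b) (hab : a ∣ b) {z : ℕ} (hz : z ∈ S) {v : ℕ} (hv : v ∈ S)
    {D : Finset ℕ} (hD : D ⊆ cofactors S v) :
    ((v / ∏ d ∈ D, d : ℕ) : ℤ) ^ a * ∏ d ∈ D, ((d : ℤ) ^ a - 1) ∣
      altSum (fun w => (Nat.lcm z w : ℤ) ^ b) v D := by
  have hle : a ≤ b := Nat.le_of_dvd hb hab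
  induction v using Nat.strong_induction_on generalizing D with
  | _ v ih =>
  have hv0 : v ≠ 0 := fun h => h0 (h ▸ hv)
  by_cases hvz : v ∣ z
  · rcases D.eq_empty_or_nonempty with rfl | hne
    · simp only [altSum, Finset.powerset_empty, Finset.sum_singleton, Finset.card_empty,
        Finset.prod_empty, pow_zero, one_mul, mul_one, Nat.div_one]
      exact (pow_dvd_pow_of_dvd (Int.natCast_dvd_natCast.2 (Nat.dvd_lcm_right z v)) a).trans
        (pow_dvd_pow _ hle)
    · have : altSum (fun w => (Nat.lcm z w : ℤ) ^ b) v D = 0 := by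
        calc altSum (fun w => (Nat.lcm z w : ℤ) ^ b) v D
            = ∑ T ∈ D.powerset, (-1) ^ T.card * (z : ℤ) ^ b := by
              refine Finset.sum_congr rfl fun T hT => ?_
              dsimp only
              rw [Nat.lcm_eq_left ((Nat.div_dvd_of_dvd (prod_dvd_of_subset_cofactors h0 hG hv
                ((Finset.mem_powerset.1 hT).trans hD))).trans hvz)]
          _ = 0 := by
              rw [← Finset.sum_mul, Finset.sum_powerset_neg_one_pow_card_of_nonempty hne,
                zero_mul]
      rw [this]
      exact dvd_zero _
  · obtain ⟨y, hy, hgy⟩ := exists_mem_GTD h0 hv (hS z hz v hv) (Nat.gcd_dvd_right z v)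
      fun h => hvz (Nat.gcd_eq_right_iff_dvd.1 h)
    obtain ⟨hyS, hylt, ⟨q, hq⟩, -⟩ := Finset.mem_filter.1 hy
    have hy0 : 0 < y := Nat.pos_of_ne_zero fun e => h0 (e ▸ hyS)
    have hq0 : 0 < q := Nat.pos_of_ne_zero fun e => hv0 (by rw [hq, e, mul_zero])
    have hvq : v / q = y := by rw [hq, Nat.mul_div_cancel _ hq0]
    have hqC : q ∈ cofactors S v := (mem_cofactors hv0).2 ⟨⟨y, by rw [hq, mul_comm]⟩, hvq ▸ hy⟩
    have hDq : D.erase q ⊆ cofactors S v := (Finset.erase_subset q D).trans hD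
    have hDy : D.erase q ⊆ cofactors S y :=
      hvq ▸ subset_cofactors_div h0 hG hv (Finset.notMem_erase q D) hqC hDq
    have hdvd := ih y hylt hyS hDy
    have hscale : altSum (fun w => (Nat.lcm z w : ℤ) ^ b) v (D.erase q) =
        (q : ℤ) ^ b * altSum (fun w => (Nat.lcm z w : ℤ) ^ b) y (D.erase q) := by
      unfold altSum
      rw [Finset.mul_sum]
      refine Finset.sum_congr rfl fun T hT => ?_
      have hT' := Finset.mem_powerset.1 hT
      obtain ⟨m, hm⟩ := prod_dvd_of_subset_cofactors h0 hG hyS (hT'.trans hDy)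
      have hP : 0 < ∏ e ∈ T, e := Nat.pos_of_ne_zero fun h => hy0.ne' (by rw [hm, h, zero_mul])
      have hcop : Nat.Coprime (∏ e ∈ T, e) q := Nat.Coprime.prod_left fun e he =>
        (cofactors_pair h0 hG hv (hDq (hT' he)) hqC (Finset.ne_of_mem_erase (hT' he))).1
      have hvm : v = q * (∏ e ∈ T, e) * m := by rw [hq, hm]; ring
      have h₁ : y / ∏ e ∈ T, e = m := by rw [hm, Nat.mul_div_cancel_left _ hP]
      have h₂ : v / ∏ e ∈ T, e = q * m := by
        rw [hvm, mul_comm q, mul_assoc, Nat.mul_div_cancel_left _ hP]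
      rw [h₁, h₂]
      dsimp only
      rw [lcm_mul_of_gcd_dvd hcop (by rwa [← hvm, ← hm])]
      push_cast
      ring
    by_cases hqD : q ∈ D
    · have hins := Finset.insert_erase hqD
      have hqb : (q : ℤ) ^ a - 1 ∣ (q : ℤ) ^ b - 1 := by
        obtain ⟨k, rfl⟩ := hab
        simpa [pow_mul] using sub_dvd_pow_sub_pow ((q : ℤ) ^ a) 1 k
      rw [← hins, altSum_insert _ _ _ (Finset.notMem_erase q D), hscale, hvq,
        Finset.prod_insert (Finset.notMem_erase q D), Finset.prod_insert (Finset.notMem_erase q D),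
        ← Nat.div_div_eq_div_mul, hvq]
      calc _ = _ := by ring
        _ ∣ _ := mul_dvd_mul hqb hdvd
        _ = _ := by ring
    · rw [Finset.erase_eq_of_notMem hqD] at hdvd hscale hDy
      obtain ⟨m, hm⟩ := prod_dvd_of_subset_cofactors h0 hG hyS hDy
      have hP : 0 < ∏ e ∈ D, e := Nat.pos_of_ne_zero fun h => hy0.ne' (by rw [hm, h, zero_mul])
      have h₁ : y / ∏ e ∈ D, e = m := by rw [hm, Nat.mul_div_cancel_left _ hP]
      have h₂ : v / ∏ e ∈ D, e = q * m := by
        rw [hq, hm, mul_assoc, Nat.mul_div_cancel_left _ hP, mul_comm]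
      rw [h₁] at hdvd
      rw [hscale, h₂, Nat.cast_mul, mul_pow, mul_assoc]
      exact mul_dvd_mul (pow_dvd_pow (q : ℤ) hle) hdvd

theorem exists_sum_filter_eq {α : Type*} [LinearOrder α] (r : α → α → Prop) [DecidableRel r]
    (s : Finset α) (hr : ∀ i ∈ s, r i i) (hle : ∀ i ∈ s, ∀ j ∈ s, r i j → i ≤ j) (f : α → ℤ) :
    ∃ g : α → ℤ, ∀ j ∈ s, ∑ i ∈ s with r i j, g i = f j := by
  induction s using Finset.induction_on_max with
  | empty => exact ⟨0, by simp⟩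
  | insert m s hm ih =>
    obtain ⟨g, hg⟩ := ih (fun i hi => hr i (Finset.mem_insert_of_mem hi)) fun i hi j hj =>
      hle i (Finset.mem_insert_of_mem hi) j (Finset.mem_insert_of_mem hj)
    have hms : m ∉ s := fun h => (hm m h).false
    have hupd : ∀ c j, ∑ i ∈ s with r i j, Function.update g m c i = ∑ i ∈ s with r i j, g i :=
      fun c j => Finset.sum_congr rfl fun i hi => Function.update_of_ne
        (ne_of_mem_of_not_mem (Finset.mem_filter.1 hi).1 hms) _ _
    refine ⟨Function.update g m (f m - ∑ i ∈ s with r i m, g i), fun j hj => ?_⟩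
    rw [Finset.filter_insert]
    rcases Finset.mem_insert.1 hj with rfl | hjs
    · rw [if_pos (hr _ hj), Finset.sum_insert (by simp [hms]), hupd, Function.update_self]
      ring
    · rw [if_neg fun h => (hm j hjs).not_ge (hle m (Finset.mem_insert_self m s) j hj h), hupd,
        hg j hjs]

/-- The function `x ↦ lcm(z, x)^b` on `S` is an integral combination of the functions
`x ↦ gcd(y, x)^a`. -/
theorem exists_lcm_pow_eq_sum_gcd_pow {S : Finset ℕ} (h0 : 0 ∉ S) (hG : condG S)
    (hS : gcdClosed S) {a b : ℕ} (hb : 0 < b) (hab : a ∣ b) {z : ℕ} (hz : z ∈ S) :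
    ∃ A : ℕ → ℤ, ∀ v ∈ S, (Nat.lcm z v : ℤ) ^ b = ∑ y ∈ S, A y * (Nat.gcd y v : ℤ) ^ a := by
  have hle : ∀ i ∈ S, ∀ j ∈ S, i ∣ j → i ≤ j := fun i _ j hj h =>
    Nat.le_of_dvd (Nat.pos_of_ne_zero fun e => h0 (e ▸ hj)) h
  obtain ⟨α, hα⟩ := exists_sum_filter_eq (· ∣ ·) S (fun i _ => dvd_rfl) hle
    fun w => (w : ℤ) ^ a
  obtain ⟨g, hg⟩ := exists_sum_filter_eq (· ∣ ·) S (fun i _ => dvd_rfl) hle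
    fun w => (Nat.lcm z w : ℤ) ^ b
  have hdvd : ∀ w ∈ S, α w ∣ g w := by
    intro w hw
    rw [← altSum_cofactors h0 hG _ α hα hw, ← altSum_cofactors h0 hG _ g hg hw,
      altSum_pow h0 hG a hw (Finset.Subset.refl _)]
    exact dvd_altSum_lcm h0 hG hS hb hab hz hw (Finset.Subset.refl _)
  choose! B hB using hdvd
  obtain ⟨A, hA⟩ : ∃ A : ℕ → ℤ, ∀ w ∈ S, ∑ y ∈ S with w ∣ y, A y = B w :=
    exists_sum_filter_eq (α := ℕᵒᵈ) (fun i j => OrderDual.ofDual j ∣ OrderDual.ofDual i) S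
      (fun _ _ => dvd_rfl) (fun i hi j hj h => hle j hj i hi h) B
  refine ⟨A, fun v hv => ?_⟩
  calc (Nat.lcm z v : ℤ) ^ b = ∑ w ∈ S with w ∣ v, α w * ∑ y ∈ S with w ∣ y, A y := by
        rw [← hg v hv]
        refine Finset.sum_congr rfl fun w hw => ?_
        have hwS := (Finset.mem_filter.1 hw).1
        rw [hB w hwS, ← hA w hwS]
    _ = ∑ y ∈ S, ∑ w ∈ S with w ∣ y ∧ w ∣ v, A y * α w := by
        simp only [Finset.mul_sum]
        rw [Finset.sum_comm' (t' := S) (s' := fun y => S.filter fun w => w ∣ y ∧ w ∣ v)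
          (by simp only [Finset.mem_filter]; tauto)]
        simp only [mul_comm]
    _ = ∑ y ∈ S, A y * (Nat.gcd y v : ℤ) ^ a := by
        refine Finset.sum_congr rfl fun y hy => ?_
        rw [← Finset.mul_sum, ← hα _ (hS y hy v hv)]
        simp only [Nat.dvd_gcd_iff]

theorem power_gcd_divides_power_lcm
    (n a b : ℕ) (ha : 0 < a) (hb : 0 < b) (hab : a ∣ b)
    (x : Fin n → ℕ) (hpos : ∀ i, 0 < x i) (hmono : StrictMono x)
    (hgcd : gcdClosed (Finset.image x Finset.univ))
    (hG : condG (Finset.image x Finset.univ))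
    (hmax : (∀ i, (GTD (Finset.image x Finset.univ) (x i)).card ≤ 3) ∧
            (∃ i, (GTD (Finset.image x Finset.univ) (x i)).card = 3)) :
    ∃ A : Matrix (Fin n) (Fin n) ℤ,
      (Matrix.of fun i j => (Nat.lcm (x i) (x j) : ℤ) ^ b)
        = A * (Matrix.of fun i j => (Nat.gcd (x i) (x j) : ℤ) ^ a) := by
  have h0 : 0 ∉ Finset.image x Finset.univ := by
    simp only [Finset.mem_image, Finset.mem_univ, true_and, not_exists]
    exact fun i => (hpos i).ne'
  have hmem : ∀ i, x i ∈ Finset.image x Finset.univ := fun i =>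
    Finset.mem_image_of_mem x (Finset.mem_univ i)
  choose A hA using fun i => exists_lcm_pow_eq_sum_gcd_pow h0 hG hgcd hb hab (hmem i)
  refine ⟨Matrix.of fun i j => A i (x j), ?_⟩
  ext i j
  rw [Matrix.mul_apply, Matrix.of_apply, hA i _ (hmem j),
    Finset.sum_image hmono.injective.injOn]
  rfl
end

section
/- Let a be a positive integer and let S = {x₁, …, xₙ} be a gcd-closed set of n distinct positive integers with x₁ < ⋯ < xₙ. Then the a-th power GCD matrix (S^a) is nonsingular, and for all 1 ≤ i, j ≤ n the (i, j) entry of its inverse (as a rational matrix) equals Σ_{k : x_i ∣ x_k and x_j ∣ x_k} c_{ik}·c_{jk} / α_{ξ_a}(x_k). -/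
open Finset

/-- Jordan's totient `J_a`, the Dirichlet convolution of `m ↦ m ^ a` with the Möbius function. -/
def jordanTotient (a : ℕ) : ArithmeticFunction ℤ :=
  (ArithmeticFunction.pow a : ArithmeticFunction ℤ) * ArithmeticFunction.moebius

theorem jordanTotient_apply {a : ℕ} (ha : 0 < a) (d : ℕ) :
    jordanTotient a d =
      ∑ e ∈ d.divisors, (e : ℤ) ^ a * ArithmeticFunction.moebius (d / e) := by
  rw [jordanTotient, ArithmeticFunction.mul_apply,
    Nat.sum_divisorsAntidiagonal fun i j : ℕ =>
      (ArithmeticFunction.pow a : ArithmeticFunction ℤ) i * ArithmeticFunction.moebius j]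
  simp [ha.ne']

theorem sum_divisors_jordanTotient {a : ℕ} (ha : 0 < a) (m : ℕ) :
    ∑ d ∈ m.divisors, jordanTotient a d = (m : ℤ) ^ a := by
  rw [← ArithmeticFunction.coe_mul_zeta_apply, jordanTotient, mul_assoc,
    ArithmeticFunction.moebius_mul_coe_zeta, mul_one]
  simp [ha.ne']

theorem jordanTotient_prime_pow_succ {a p : ℕ} (ha : 0 < a) (hp : p.Prime) (k : ℕ) :
    jordanTotient a (p ^ (k + 1)) = ((p : ℤ) ^ (k + 1)) ^ a - ((p : ℤ) ^ k) ^ a := by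
  have h₁ := sum_divisors_jordanTotient ha (p ^ (k + 1))
  have h₀ := sum_divisors_jordanTotient ha (p ^ k)
  rw [Nat.sum_divisors_prime_pow hp] at h₀ h₁
  rw [Finset.sum_range_succ, h₀] at h₁
  push_cast at h₁
  linarith

theorem jordanTotient_pos {a : ℕ} (ha : 0 < a) {d : ℕ} (hd : d ≠ 0) :
    0 < jordanTotient a d := by
  have hmul : (jordanTotient a).IsMultiplicative :=
    ArithmeticFunction.isMultiplicative_pow.natCast.mul
      ArithmeticFunction.isMultiplicative_moebius
  rw [hmul.multiplicative_factorization _ hd]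
  refine Finset.prod_pos fun p hp => ?_
  have hprime : p.Prime := Nat.prime_of_mem_primeFactors hp
  obtain ⟨k, hk⟩ : ∃ k, d.factorization p = k + 1 :=
    Nat.exists_eq_succ_of_ne_zero (Finsupp.mem_support_iff.mp hp)
  simp only [hk]
  rw [jordanTotient_prime_pow_succ ha hprime, sub_pos]
  refine pow_lt_pow_left₀ ?_ (by positivity) ha.ne'
  exact pow_lt_pow_right₀ (by exact_mod_cast hprime.one_lt) k.lt_succ_self

theorem sum_moebius_filter_mul_dvd {m N : ℕ} (hm : 0 < m) (Q : ℕ → Prop) [DecidablePred Q] :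
    ∑ d ∈ N.divisors.filter (fun d => d * m ∣ N ∧ Q (d * m)), ArithmeticFunction.moebius d =
      ∑ e ∈ N.divisors.filter Q, if m ∣ e then ArithmeticFunction.moebius (e / m) else 0 := by
  rw [← Finset.sum_filter]
  refine Finset.sum_nbij' (· * m) (· / m) ?_ ?_ ?_ ?_ ?_
  · intro d hd
    simp only [Finset.mem_filter, Nat.mem_divisors] at hd ⊢
    exact ⟨⟨⟨hd.2.1, hd.1.2⟩, hd.2.2⟩, Dvd.intro_left d rfl⟩
  · intro e he
    simp only [Finset.mem_filter, Nat.mem_divisors] at he ⊢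
    obtain ⟨⟨⟨heN, hN⟩, hQ⟩, hme⟩ := he
    rw [Nat.div_mul_cancel hme]
    exact ⟨⟨(Nat.div_dvd_of_dvd hme).trans heN, hN⟩, heN, hQ⟩
  · intro d _
    exact Nat.mul_div_cancel d hm
  · intro e he
    exact Nat.div_mul_cancel (Finset.mem_filter.mp he).2
  · intro d _
    simp only [Nat.mul_div_cancel d hm]

theorem sum_divisors_moebius_div {m N : ℕ} (hm : 0 < m) (hN : 0 < N) :
    ∑ e ∈ N.divisors, (if m ∣ e then ArithmeticFunction.moebius (e / m) else 0) =
      if N = m then 1 else 0 := by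
  have h := sum_moebius_filter_mul_dvd (N := N) hm fun _ => True
  simp only [and_true, Finset.filter_true] at h
  rw [← h]
  by_cases hmN : m ∣ N
  · obtain ⟨q, rfl⟩ := hmN
    have hq : 0 < q := Nat.pos_of_mul_pos_left hN
    have hfilter : (m * q).divisors.filter (fun d => d * m ∣ m * q) = q.divisors := by
      ext d
      simp only [Finset.mem_filter, Nat.mem_divisors, mul_comm d m,
        Nat.mul_dvd_mul_iff_left hm]
      exact ⟨fun hd => ⟨hd.2, hq.ne'⟩, fun hd => ⟨⟨hd.1.mul_left m, hN.ne'⟩, hd.1⟩⟩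
    rw [hfilter, ← ArithmeticFunction.coe_mul_zeta_apply,
      ArithmeticFunction.moebius_mul_coe_zeta, ArithmeticFunction.one_apply]
    simp [hm.ne']
  · rw [Finset.sum_eq_zero, if_neg]
    · rintro rfl
      exact hmN dvd_rfl
    · intro d hd
      exact absurd ((Dvd.intro_left d rfl).trans (Finset.mem_filter.mp hd).2) hmN

section GcdClosed

variable {n : ℕ} {x : Fin n → ℕ}

theorem exists_eq_gcd_of_gcdClosed (hgcd : gcdClosed (Finset.image x Finset.univ))
    (i j : Fin n) : ∃ m, x m = Nat.gcd (x i) (x j) := by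
  simpa using hgcd (x i) (by simp) (x j) (by simp)

/-- In a gcd-closed set, the elements `x_t` divisible by `d` are exactly the multiples of the
least of them. -/
theorem exists_forall_dvd_iff (hpos : ∀ i, 0 < x i)
    (hgcd : gcdClosed (Finset.image x Finset.univ)) {d : ℕ} {l : Fin n} (hd : d ∣ x l) :
    ∃ k, ∀ t, d ∣ x t ↔ x k ∣ x t := by
  obtain ⟨k, hk, hmin⟩ := Finset.exists_min_image
    (Finset.univ.filter fun t => d ∣ x t) x ⟨l, by simpa using hd⟩
  simp only [Finset.mem_filter, Finset.mem_univ, true_and] at hk hmin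
  refine ⟨k, fun t => ⟨fun ht => ?_, hk.trans⟩⟩
  obtain ⟨m, hm⟩ := exists_eq_gcd_of_gcdClosed hgcd k t
  have hle : x k ≤ x m := hmin m (hm ▸ Nat.dvd_gcd hk ht)
  have heq : Nat.gcd (x k) (x t) = x k :=
    le_antisymm (Nat.gcd_le_left _ (hpos k)) (hm ▸ hle)
  exact Nat.gcd_eq_left_iff_dvd.mp heq

/-- The divisors of `x l` are partitioned according to the least element of the set that they
divide. -/
theorem sum_sum_divisors_filter (hpos : ∀ i, 0 < x i) (hmono : StrictMono x)
    (hgcd : gcdClosed (Finset.image x Finset.univ)) (g : ℕ → ℤ) (l : Fin n) :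
    ∑ k ∈ Finset.univ.filter (fun k => x k ∣ x l),
        ∑ d ∈ (x k).divisors.filter (fun d => ∀ t : Fin n, x t < x k → ¬ d ∣ x t), g d =
      ∑ d ∈ (x l).divisors, g d := by
  rw [← Finset.sum_biUnion]
  · refine Finset.sum_congr ?_ fun _ _ => rfl
    ext d
    simp only [Finset.mem_biUnion, Finset.mem_filter, Finset.mem_univ, true_and,
      Nat.mem_divisors]
    constructor
    · rintro ⟨k, hkl, ⟨hdk, -⟩, -⟩
      exact ⟨hdk.trans hkl, (hpos l).ne'⟩
    · rintro ⟨hdl, -⟩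
      obtain ⟨k, hk⟩ := exists_forall_dvd_iff hpos hgcd hdl
      exact ⟨k, (hk l).mp hdl, ⟨(hk k).mpr dvd_rfl, (hpos k).ne'⟩, fun t ht hdt =>
        (Nat.le_of_dvd (hpos t) ((hk t).mp hdt)).not_gt ht⟩
  · intro k _ k' _ hne
    refine Finset.disjoint_left.mpr fun d hd hd' => ?_
    simp only [Finset.mem_filter, Nat.mem_divisors] at hd hd'
    rcases lt_trichotomy (x k) (x k') with h | h | h
    · exact hd'.2 k h hd.1.1
    · exact hne (hmono.injective h)
    · exact hd.2 k' h hd'.1.1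

theorem cMat_eq_sum (hpos : ∀ i, 0 < x i) (i k : Fin n) :
    cMat x i k =
      ∑ e ∈ (x k).divisors.filter (fun d => ∀ t : Fin n, x t < x k → ¬ d ∣ x t),
        if x i ∣ e then ArithmeticFunction.moebius (e / x i) else 0 :=
  sum_moebius_filter_mul_dvd (hpos i) fun e => ∀ t : Fin n, x t < x k → ¬ e ∣ x t

theorem cMat_eq_zero {i k : Fin n} (h : ¬ x i ∣ x k) : cMat x i k = 0 :=
  Finset.sum_eq_zero fun d hd =>
    absurd ((Dvd.intro_left d rfl).trans (Finset.mem_filter.mp hd).2.1) h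

theorem sum_cMat (hpos : ∀ i, 0 < x i) (hmono : StrictMono x)
    (hgcd : gcdClosed (Finset.image x Finset.univ)) (i l : Fin n) :
    ∑ k ∈ Finset.univ.filter (fun k => x k ∣ x l), cMat x i k = if l = i then 1 else 0 := by
  simp only [cMat_eq_sum hpos]
  rw [sum_sum_divisors_filter hpos hmono hgcd, sum_divisors_moebius_div (hpos i) (hpos l)]
  simp only [hmono.injective.eq_iff]

theorem alphaXi_eq_sum_jordanTotient {a : ℕ} (ha : 0 < a) (k : Fin n) :
    alphaXi a x k =
      ∑ d ∈ (x k).divisors.filter (fun d => ∀ t : Fin n, x t < x k → ¬ d ∣ x t),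
        jordanTotient a d := by
  simp only [jordanTotient_apply ha, alphaXi]

theorem alphaXi_pos {a : ℕ} (ha : 0 < a) (hpos : ∀ i, 0 < x i) (k : Fin n) :
    0 < alphaXi a x k := by
  rw [alphaXi_eq_sum_jordanTotient ha]
  refine Finset.sum_pos (fun d hd => jordanTotient_pos ha
    (Nat.pos_of_mem_divisors (Finset.mem_filter.mp hd).1).ne') ⟨x k, ?_⟩
  simp only [Finset.mem_filter, Nat.mem_divisors]
  exact ⟨⟨dvd_rfl, (hpos k).ne'⟩, fun t ht hdvd => (Nat.le_of_dvd (hpos t) hdvd).not_gt ht⟩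

theorem sum_alphaXi {a : ℕ} (ha : 0 < a) (hpos : ∀ i, 0 < x i) (hmono : StrictMono x)
    (hgcd : gcdClosed (Finset.image x Finset.univ)) (i j : Fin n) :
    ∑ k ∈ Finset.univ.filter (fun k => x k ∣ x i ∧ x k ∣ x j), alphaXi a x k =
      (Nat.gcd (x i) (x j) : ℤ) ^ a := by
  obtain ⟨m, hm⟩ := exists_eq_gcd_of_gcdClosed hgcd i j
  simp only [← Nat.dvd_gcd_iff, ← hm, alphaXi_eq_sum_jordanTotient ha]
  rw [sum_sum_divisors_filter hpos hmono hgcd, sum_divisors_jordanTotient ha]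

end GcdClosed

theorem power_gcd_matrix_inverse
    (n a : ℕ) (ha : 0 < a)
    (x : Fin n → ℕ) (hpos : ∀ i, 0 < x i) (hmono : StrictMono x)
    (hgcd : gcdClosed (Finset.image x Finset.univ)) :
    (Matrix.of fun i j : Fin n => (Nat.gcd (x i) (x j) : ℚ) ^ a).det ≠ 0 ∧
    ∀ i j : Fin n,
      (Matrix.of fun i j : Fin n => (Nat.gcd (x i) (x j) : ℚ) ^ a)⁻¹ i j =
        ∑ k ∈ Finset.univ.filter (fun k : Fin n => x i ∣ x k ∧ x j ∣ x k),
          (cMat x i k : ℚ) * (cMat x j k : ℚ) / (alphaXi a x k : ℚ) := by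
  classical
  set G : Matrix (Fin n) (Fin n) ℚ :=
    Matrix.of fun i j : Fin n => (Nat.gcd (x i) (x j) : ℚ) ^ a with hG
  let E : Matrix (Fin n) (Fin n) ℚ := Matrix.of fun i k => if x k ∣ x i then 1 else 0
  let C : Matrix (Fin n) (Fin n) ℚ := Matrix.of fun i k => (cMat x i k : ℚ)
  let α : Fin n → ℚ := fun k => (alphaXi a x k : ℚ)
  have hα : ∀ k, α k ≠ 0 := fun k =>
    Int.cast_ne_zero.mpr (alphaXi_pos ha hpos k).ne'
  have hEC : E * C.transpose = 1 := by
    ext l i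
    have h := congrArg (Int.cast : ℤ → ℚ) (sum_cMat hpos hmono hgcd i l)
    push_cast at h
    simpa [Matrix.mul_apply, Matrix.one_apply, E, C, Finset.sum_filter] using h
  have hEC' : E.transpose * C = 1 := by
    rw [mul_eq_one_comm, ← Matrix.transpose_inj, Matrix.transpose_mul]
    simpa using hEC
  have hGE : G = E * Matrix.diagonal α * E.transpose := by
    ext i j
    have h := congrArg (Int.cast : ℤ → ℚ) (sum_alphaXi ha hpos hmono hgcd i j)
    push_cast at h
    rw [Finset.sum_filter] at h
    rw [hG, Matrix.of_apply, ← h, Matrix.mul_apply]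
    refine Finset.sum_congr rfl fun k _ => ?_
    by_cases hi : x k ∣ x i <;> by_cases hj : x k ∣ x j <;>
      simp [Matrix.mul_diagonal, E, α, hi, hj]
  have hdiag : Matrix.diagonal α * Matrix.diagonal α⁻¹ = 1 := by
    rw [Matrix.diagonal_mul_diagonal, ← Matrix.diagonal_one]
    congr 1
    ext k
    exact mul_inv_cancel₀ (hα k)
  have hinv : G * (C * Matrix.diagonal α⁻¹ * C.transpose) = 1 := by
    calc G * (C * Matrix.diagonal α⁻¹ * C.transpose)
        = E * Matrix.diagonal α * (E.transpose * C) * Matrix.diagonal α⁻¹ * C.transpose := by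
          rw [hGE]; simp only [Matrix.mul_assoc]
      _ = E * (Matrix.diagonal α * Matrix.diagonal α⁻¹) * C.transpose := by
          rw [hEC', Matrix.mul_one]; simp only [Matrix.mul_assoc]
      _ = 1 := by rw [hdiag, Matrix.mul_one, hEC]
  refine ⟨(Matrix.isUnit_det_of_right_inverse hinv).ne_zero, fun i j => ?_⟩
  rw [Matrix.inv_eq_right_inv hinv, Matrix.mul_apply, Finset.sum_filter]
  refine Finset.sum_congr rfl fun k _ => ?_
  split_ifs with h
  · simp only [Matrix.mul_diagonal, Matrix.transpose_apply, Matrix.of_apply, Pi.inv_apply, C, α]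
    ring
  · rcases not_and_or.mp h with h | h <;> simp [C, cMat_eq_zero h]
end

section
/- Let S = {x₁, …, xₙ} be a gcd-closed set of n distinct positive integers satisfying condition 𝒢, and let x_m ∈ S with G_S(x_m) = {x_{m₁}, x_{m₂}, x_{m₃}} consisting of exactly three elements. Set x_{m₄} := gcd(x_{m₁}, x_{m₂}, x_{m₃}) and x_{m_{ij}} := gcd(x_{m_i}, x_{m_j}) for 1 ≤ i < j ≤ 3. Then for every r with 1 ≤ r ≤ n: c_{rm} = 1 if x_r = x_m or x_r = x_{m_{ij}} for some 1 ≤ i < j ≤ 3; c_{rm} = −1 if x_r = x_{m_i} for some 1 ≤ i ≤ 4; and c_{rm} = 0 otherwise. -/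
open Finset

theorem sum_moebius_divisors (k : ℕ) :
    ∑ d ∈ k.divisors, ArithmeticFunction.moebius d = if k = 1 then 1 else 0 := by
  rw [← ArithmeticFunction.coe_mul_zeta_apply, ArithmeticFunction.moebius_mul_coe_zeta,
    ArithmeticFunction.one_apply]

theorem sum_moebius_ite_mul_dvd {a b x : ℕ} (ha : 0 < a) (hx : 0 < x) (hb : b ∣ x) :
    (∑ d ∈ x.divisors, if d * a ∣ b then ArithmeticFunction.moebius d else 0) =
      if a = b then 1 else 0 := by
  have hb0 : 0 < b := Nat.pos_of_dvd_of_pos hb hx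
  rw [← Finset.sum_filter]
  by_cases hab : a ∣ b
  · obtain ⟨k, rfl⟩ := hab
    have hfilter : x.divisors.filter (fun d => d * a ∣ a * k) = k.divisors := by
      ext d
      rw [Finset.mem_filter, Nat.mem_divisors, Nat.mem_divisors, mul_comm d a,
        Nat.mul_dvd_mul_iff_left ha]
      exact ⟨fun h => ⟨h.2, (Nat.pos_of_mul_pos_left hb0).ne'⟩,
        fun h => ⟨⟨(h.1.mul_left a).trans hb, hx.ne'⟩, h.1⟩⟩
    rw [hfilter, sum_moebius_divisors]
    refine if_congr ?_ rfl rfl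
    rw [eq_comm (a := a), Nat.mul_eq_left ha.ne']
  · rw [if_neg fun h => hab h.dvd, Finset.filter_false_of_mem, Finset.sum_empty]
    exact fun d _ h => hab ((dvd_mul_left a d).trans h)

/-- Every proper divisor of `x` in `S` divides a greatest-type divisor of `x` in `S`. -/
theorem exists_mem_GTD_of_dvd {S : Finset ℕ} {x g : ℕ} (hg : g ∈ S) (hgx : g ∣ x) (hlt : g < x) :
    ∃ d ∈ GTD S x, g ∣ d := by
  obtain ⟨d, hd, hmax⟩ := (S.filter fun d => g ∣ d ∧ d ∣ x ∧ d < x).exists_max_image id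
    ⟨g, by simp [hg, hgx, hlt]⟩
  simp only [Finset.mem_filter, id] at hd hmax
  obtain ⟨hdS, hgd, hdx, hdlt⟩ := hd
  refine ⟨d, Finset.mem_filter.2 ⟨hdS, hdlt, hdx, fun y hy hdy hyx => ?_⟩, hgd⟩
  have hyle : y ≤ x := Nat.le_of_dvd (by omega) hyx
  by_contra! hne
  have hylt : y < x := lt_of_le_of_ne hyle hne.2
  have h := hmax y ⟨hy, hgd.trans hdy, hyx, hylt⟩
  by_cases hy0 : y = 0
  · subst hy0
    have := zero_dvd_iff.1 hyx
    omega
  · exact hne.1 (le_antisymm h (Nat.le_of_dvd (Nat.pos_of_ne_zero hy0) hdy))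

/-- Greatest-type divisors form an antichain for divisibility. -/
theorem eq_of_mem_GTD_of_dvd {S : Finset ℕ} {x y z : ℕ} (hy : y ∈ GTD S x) (hz : z ∈ GTD S x)
    (h : y ∣ z) : y = z := by
  simp only [GTD, Finset.mem_filter] at hy hz
  rcases hy.2.2.2 z hz.1 h hz.2.2.1 with h | h
  · exact h.symm
  · exact absurd h hz.2.1.ne

/-- Under condition 𝒢, the gcds of a greatest-type divisor with two others are incomparable. -/
theorem eq_of_gcd_dvd_gcd {S : Finset ℕ} {x a b c : ℕ} (hx : 0 < x) (hG : condGAt S x)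
    (ha : a ∈ GTD S x) (hb : b ∈ GTD S x) (hc : c ∈ GTD S x) (hab : a ≠ b) (hac : a ≠ c)
    (h : Nat.gcd a b ∣ Nat.gcd a c) : b = c := by
  obtain ⟨hlb, hgb, -⟩ := hG a ha b hb hab
  obtain ⟨hlc, hgc, -⟩ := hG a ha c hc hac
  have hgcd := eq_of_mem_GTD_of_dvd hgb hgc h
  have ha0 : 0 < a := by
    simp only [GTD, Finset.mem_filter] at ha
    exact Nat.pos_of_dvd_of_pos ha.2.2.1 hx
  refine Nat.eq_of_mul_eq_mul_left ha0 ?_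
  rw [← Nat.gcd_mul_lcm a b, ← Nat.gcd_mul_lcm a c, hgcd, hlb, hlc]

theorem dvd_of_mem_GTD {S : Finset ℕ} {x y : ℕ} (hy : y ∈ GTD S x) : y ∣ x := by
  simp only [GTD, Finset.mem_filter] at hy
  exact hy.2.2.1

theorem lt_of_mem_GTD {S : Finset ℕ} {x y : ℕ} (hy : y ∈ GTD S x) : y < x := by
  simp only [GTD, Finset.mem_filter] at hy
  exact hy.2.1

/-- In a gcd-closed set, a divisor of `x m` divides no smaller element of the set if and only if
it divides no greatest-type divisor of `x m`. -/
theorem forall_not_dvd_iff_forall_GTD {n : ℕ} {x : Fin n → ℕ} (hpos : ∀ i, 0 < x i)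
    (hgcd : gcdClosed (Finset.image x Finset.univ)) {m : Fin n} {e : ℕ} (he : e ∣ x m) :
    (∀ t : Fin n, x t < x m → ¬ e ∣ x t) ↔
      ∀ y ∈ GTD (Finset.image x Finset.univ) (x m), ¬ e ∣ y := by
  constructor
  · intro h y hy
    have hlt := lt_of_mem_GTD hy
    obtain ⟨t, -, rfl⟩ := Finset.mem_image.1 (Finset.mem_filter.1 hy).1
    exact h t hlt
  · intro h t ht het
    obtain ⟨y, hy, hgy⟩ := exists_mem_GTD_of_dvd
      (hgcd _ (Finset.mem_image_of_mem x (Finset.mem_univ t))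
        _ (Finset.mem_image_of_mem x (Finset.mem_univ m)))
      (Nat.gcd_dvd_right (x t) (x m))
      ((Nat.le_of_dvd (hpos t) (Nat.gcd_dvd_left (x t) (x m))).trans_lt ht)
    exact h y hy ((Nat.dvd_gcd het he).trans hgy)

/-- Inclusion–exclusion formula for `cMat` when there are three greatest-type divisors. -/
theorem cMat_eq_of_GTD_eq {n : ℕ} {x : Fin n → ℕ} (hpos : ∀ i, 0 < x i)
    (hgcd : gcdClosed (Finset.image x Finset.univ)) {m : Fin n} {a b c : ℕ}
    (hGTD : GTD (Finset.image x Finset.univ) (x m) = {a, b, c}) (r : Fin n) :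
    cMat x r m = (if x r = x m then 1 else 0) - (if x r = a then 1 else 0)
      - (if x r = b then 1 else 0) - (if x r = c then 1 else 0)
      + (if x r = Nat.gcd a b then 1 else 0) + (if x r = Nat.gcd a c then 1 else 0)
      + (if x r = Nat.gcd b c then 1 else 0)
      - (if x r = Nat.gcd (Nat.gcd a b) c then 1 else 0) := by
  have hax : a ∣ x m :=
    dvd_of_mem_GTD (S := Finset.image x Finset.univ) (by simp [hGTD])
  have hbx : b ∣ x m :=
    dvd_of_mem_GTD (S := Finset.image x Finset.univ) (by simp [hGTD])
  have hcx : c ∣ x m :=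
    dvd_of_mem_GTD (S := Finset.image x Finset.univ) (by simp [hGTD])
  have hr := hpos r
  have hm := hpos m
  rw [← sum_moebius_ite_mul_dvd hr hm (dvd_refl (x m)),
    ← sum_moebius_ite_mul_dvd hr hm hax, ← sum_moebius_ite_mul_dvd hr hm hbx,
    ← sum_moebius_ite_mul_dvd hr hm hcx,
    ← sum_moebius_ite_mul_dvd hr hm ((Nat.gcd_dvd_left a b).trans hax),
    ← sum_moebius_ite_mul_dvd hr hm ((Nat.gcd_dvd_left a c).trans hax),
    ← sum_moebius_ite_mul_dvd hr hm ((Nat.gcd_dvd_left b c).trans hbx),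
    ← sum_moebius_ite_mul_dvd hr hm ((Nat.gcd_dvd_right (Nat.gcd a b) c).trans hcx),
    cMat, Finset.sum_filter]
  simp only [← Finset.sum_sub_distrib, ← Finset.sum_add_distrib]
  refine Finset.sum_congr rfl fun d _ => ?_
  by_cases hd : d * x r ∣ x m
  · simp only [forall_not_dvd_iff_forall_GTD hpos hgcd hd, hGTD, Finset.mem_insert,
      Finset.mem_singleton, forall_eq_or_imp, forall_eq, Nat.dvd_gcd_iff]
    by_cases ha : d * x r ∣ a <;> by_cases hb : d * x r ∣ b <;> by_cases hc : d * x r ∣ c <;>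
      simp [hd, ha, hb, hc]
  · have ha : ¬ d * x r ∣ a := fun h => hd (h.trans hax)
    have hb : ¬ d * x r ∣ b := fun h => hd (h.trans hbx)
    have hc : ¬ d * x r ∣ c := fun h => hd (h.trans hcx)
    simp [hd, ha, hb, hc, Nat.dvd_gcd_iff]

theorem cMat_values_three_gtds
    (n : ℕ) (x : Fin n → ℕ) (hpos : ∀ i, 0 < x i) (hmono : StrictMono x)
    (hgcd : gcdClosed (Finset.image x Finset.univ))
    (hG : condG (Finset.image x Finset.univ))
    (m : Fin n) (y₁ y₂ y₃ : ℕ)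
    (hGTD : GTD (Finset.image x Finset.univ) (x m) = {y₁, y₂, y₃})
    (hcard : ({y₁, y₂, y₃} : Finset ℕ).card = 3) :
    ∀ r : Fin n,
      ((x r = x m ∨ x r = Nat.gcd y₁ y₂ ∨ x r = Nat.gcd y₁ y₃ ∨ x r = Nat.gcd y₂ y₃) →
        cMat x r m = 1) ∧
      ((x r = y₁ ∨ x r = y₂ ∨ x r = y₃ ∨ x r = Nat.gcd (Nat.gcd y₁ y₂) y₃) →
        cMat x r m = -1) ∧
      (¬ (x r = x m ∨ x r = Nat.gcd y₁ y₂ ∨ x r = Nat.gcd y₁ y₃ ∨ x r = Nat.gcd y₂ y₃) →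
       ¬ (x r = y₁ ∨ x r = y₂ ∨ x r = y₃ ∨ x r = Nat.gcd (Nat.gcd y₁ y₂) y₃) →
        cMat x r m = 0) := by
  intro r
  have h12 : y₁ ≠ y₂ := by
    rintro rfl
    have := Finset.card_le_two (a := y₁) (b := y₃)
    simp at hcard
    omega
  have h13 : y₁ ≠ y₃ := by
    rintro rfl
    have := Finset.card_le_two (a := y₂) (b := y₁)
    simp at hcard
    omega
  have h23 : y₂ ≠ y₃ := by
    rintro rfl
    have := Finset.card_le_two (a := y₁) (b := y₂)
    simp at hcard
    omega
  have m1 : y₁ ∈ GTD (Finset.image x Finset.univ) (x m) := by simp [hGTD]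
  have m2 : y₂ ∈ GTD (Finset.image x Finset.univ) (x m) := by simp [hGTD]
  have m3 : y₃ ∈ GTD (Finset.image x Finset.univ) (x m) := by simp [hGTD]
  have hGm := hG (x m) (Finset.mem_image_of_mem x (Finset.mem_univ m))
  have hm := hpos m
  have hlt1 := lt_of_mem_GTD m1
  have hlt2 := lt_of_mem_GTD m2
  have hlt3 := lt_of_mem_GTD m3
  have hlt12 := lt_of_mem_GTD (hGm y₁ m1 y₂ m2 h12).2.1
  have hlt12' := lt_of_mem_GTD (hGm y₁ m1 y₂ m2 h12).2.2
  have hlt13 := lt_of_mem_GTD (hGm y₁ m1 y₃ m3 h13).2.1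
  have hlt13' := lt_of_mem_GTD (hGm y₁ m1 y₃ m3 h13).2.2
  have hlt23 := lt_of_mem_GTD (hGm y₂ m2 y₃ m3 h23).2.1
  have hlt23' := lt_of_mem_GTD (hGm y₂ m2 y₃ m3 h23).2.2
  have n12 : ¬ Nat.gcd y₁ y₂ ∣ y₃ := fun h =>
    h23 (eq_of_gcd_dvd_gcd hm hGm m1 m2 m3 h12 h13 (Nat.dvd_gcd (Nat.gcd_dvd_left _ _) h))
  have n13 : ¬ Nat.gcd y₁ y₃ ∣ y₂ := fun h =>
    h23.symm (eq_of_gcd_dvd_gcd hm hGm m1 m3 m2 h13 h12 (Nat.dvd_gcd (Nat.gcd_dvd_left _ _) h))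
  have n23 : ¬ Nat.gcd y₂ y₃ ∣ y₁ := fun h =>
    h13.symm (eq_of_gcd_dvd_gcd hm hGm m2 m3 m1 h23 h12.symm
      (Nat.dvd_gcd (Nat.gcd_dvd_left _ _) h))
  rw [cMat_eq_of_GTD_eq hpos hgcd hGTD r]
  have d12 := Nat.gcd_dvd_left y₁ y₂
  have d12' := Nat.gcd_dvd_right y₁ y₂
  have d13 := Nat.gcd_dvd_left y₁ y₃
  have d13' := Nat.gcd_dvd_right y₁ y₃
  have d23 := Nat.gcd_dvd_left y₂ y₃
  have d23' := Nat.gcd_dvd_right y₂ y₃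
  have d4 := Nat.gcd_dvd_left (Nat.gcd y₁ y₂) y₃
  have d4' := Nat.gcd_dvd_right (Nat.gcd y₁ y₂) y₃
  have hle12 := Nat.le_of_dvd (Nat.pos_of_dvd_of_pos d12 (by omega)) d4
  have hle13 := Nat.le_of_dvd (Nat.pos_of_dvd_of_pos d13 (by omega))
    (Nat.dvd_gcd (d4.trans d12) d4')
  have d42 := d4.trans d12'
  have d41 := d4.trans d12
  have e12 : Nat.gcd y₁ y₂ ≠ y₃ := fun h => n12 h.dvd
  have e13 : Nat.gcd y₁ y₃ ≠ y₂ := fun h => n13 h.dvd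
  have e23 : Nat.gcd y₂ y₃ ≠ y₁ := fun h => n23 h.dvd
  clear hGTD hcard hGm hG hgcd hmono m1 m2 m3 hpos
  generalize Nat.gcd (Nat.gcd y₁ y₂) y₃ = g at *
  generalize Nat.gcd y₁ y₂ = g₁₂ at *
  generalize Nat.gcd y₁ y₃ = g₁₃ at *
  generalize Nat.gcd y₂ y₃ = g₂₃ at *
  refine ⟨?_, ?_, ?_⟩ <;> grind
end

section
/- Let S be a gcd-closed set of distinct positive integers satisfying condition 𝒢, and let x_m ∈ S with G_S(x_m) = {x_{m₁}, x_{m₂}, x_{m₃}} consisting of exactly three elements; set x_{m_{ij}} := gcd(x_{m_i}, x_{m_j}) for 1 ≤ i < j ≤ 3 and x_{m₄} := gcd(x_{m₁}, x_{m₂}, x_{m₃}). Then x_m·x_{m_{12}} = x_{m₁}·x_{m₂}, x_{m_{13}}·x_{m₂} = x_{m₄}·x_m, x_{m_{23}}·x_{m₁} = x_{m₄}·x_m, and x_{m₃}·x_{m₁}·x_{m₂} = x_{m₄}·x_m². -/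
open Finset

theorem lcm_gcd_eq_gcd_lcm_lcm {a b c : ℕ} (ha : a ≠ 0) (hb : b ≠ 0) (hc : c ≠ 0) :
    Nat.lcm (Nat.gcd a b) c = Nat.gcd (Nat.lcm a c) (Nat.lcm b c) := by
  have hab : Nat.gcd a b ≠ 0 := Nat.gcd_ne_zero_left ha
  have hac : Nat.lcm a c ≠ 0 := Nat.lcm_ne_zero ha hc
  have hbc : Nat.lcm b c ≠ 0 := Nat.lcm_ne_zero hb hc
  refine Nat.eq_of_factorization_eq (Nat.lcm_ne_zero hab hc) (Nat.gcd_ne_zero_left hac) fun p => ?_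
  rw [Nat.factorization_lcm hab hc, Nat.factorization_gcd hac hbc, Nat.factorization_gcd ha hb,
    Nat.factorization_lcm ha hc, Nat.factorization_lcm hb hc]
  simp only [Finsupp.sup_apply, Finsupp.inf_apply]
  exact sup_inf_right _ _ _

theorem gcd_mul_eq_gcd_gcd_mul_of_lcm_eq {a b c x : ℕ} (ha : a ≠ 0) (hb : b ≠ 0) (hc : c ≠ 0)
    (hac : Nat.lcm a c = x) (hbc : Nat.lcm b c = x) :
    Nat.gcd a b * c = Nat.gcd (Nat.gcd a b) c * x := by
  rw [← Nat.gcd_mul_lcm (Nat.gcd a b) c, lcm_gcd_eq_gcd_lcm_lcm ha hb hc, hac, hbc,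
    Nat.gcd_self]

theorem gtd_product_identities
    (S : Finset ℕ) (hpos : ∀ u ∈ S, 0 < u) (hgcd : gcdClosed S) (hG : condG S)
    (xm y₁ y₂ y₃ : ℕ) (hm : xm ∈ S)
    (hGTD : GTD S xm = {y₁, y₂, y₃}) (hcard : ({y₁, y₂, y₃} : Finset ℕ).card = 3) :
    xm * Nat.gcd y₁ y₂ = y₁ * y₂ ∧
    Nat.gcd y₁ y₃ * y₂ = Nat.gcd (Nat.gcd y₁ y₂) y₃ * xm ∧
    Nat.gcd y₂ y₃ * y₁ = Nat.gcd (Nat.gcd y₁ y₂) y₃ * xm ∧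
    y₃ * y₁ * y₂ = Nat.gcd (Nat.gcd y₁ y₂) y₃ * xm ^ 2 := by
  have h₁₂ : y₁ ≠ y₂ := by
    rintro rfl
    have := Finset.card_le_two (a := y₁) (b := y₃)
    simp only [Finset.insert_eq_of_mem (Finset.mem_insert_self y₁ {y₃})] at hcard
    omega
  have h₁₃ : y₁ ≠ y₃ := by
    rintro rfl
    have := Finset.card_le_two (a := y₂) (b := y₁)
    rw [Finset.insert_eq_of_mem (by simp)] at hcard
    omega
  have h₂₃ : y₂ ≠ y₃ := by
    rintro rfl
    have := Finset.card_le_two (a := y₁) (b := y₂)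
    rw [Finset.pair_eq_singleton] at hcard
    omega
  have m₁ : y₁ ∈ GTD S xm := by simp [hGTD]
  have m₂ : y₂ ∈ GTD S xm := by simp [hGTD]
  have m₃ : y₃ ∈ GTD S xm := by simp [hGTD]
  have ne_zero {d : ℕ} (hd : d ∈ GTD S xm) : d ≠ 0 := (hpos d (Finset.mem_filter.1 hd).1).ne'
  have l₁₂ := (hG xm hm y₁ m₁ y₂ m₂ h₁₂).1
  have l₁₃ := (hG xm hm y₁ m₁ y₃ m₃ h₁₃).1
  have l₂₃ := (hG xm hm y₂ m₂ y₃ m₃ h₂₃).1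
  have e₁₂ : xm * Nat.gcd y₁ y₂ = y₁ * y₂ := by
    rw [← Nat.gcd_mul_lcm y₁ y₂, l₁₂, mul_comm]
  have e₃ := gcd_mul_eq_gcd_gcd_mul_of_lcm_eq (ne_zero m₁) (ne_zero m₂) (ne_zero m₃) l₁₃ l₂₃
  refine ⟨e₁₂, ?_, ?_, ?_⟩
  · rw [Nat.gcd_right_comm y₁ y₂ y₃]
    exact gcd_mul_eq_gcd_gcd_mul_of_lcm_eq (ne_zero m₁) (ne_zero m₃) (ne_zero m₂) l₁₂
      (Nat.lcm_comm y₃ y₂ ▸ l₂₃)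
  · rw [Nat.gcd_assoc, Nat.gcd_comm y₁]
    exact gcd_mul_eq_gcd_gcd_mul_of_lcm_eq (ne_zero m₂) (ne_zero m₃) (ne_zero m₁)
      (Nat.lcm_comm y₂ y₁ ▸ l₁₂) (Nat.lcm_comm y₃ y₁ ▸ l₁₃)
  · linear_combination xm * e₃ - y₃ * e₁₂
end

section
/- Let S be a gcd-closed set of distinct positive integers satisfying condition 𝒢, let a be a positive integer, and let x_m ∈ S with G_S(x_m) = {x_{m₁}, x_{m₂}, x_{m₃}} consisting of exactly three elements; set x_{m_{ij}} := gcd(x_{m_i}, x_{m_j}) for 1 ≤ i < j ≤ 3 and x_{m₄} := gcd(x_{m₁}, x_{m₂}, x_{m₃}). Then x_{m₁} ∣ x_m, x_{m₂} ∣ x_m, x_m ∣ x_{m₁}·x_{m₂}, and x_m^a − x_{m₁}^a − x_{m₂}^a − x_{m₃}^a + x_{m_{12}}^a + x_{m_{13}}^a + x_{m_{23}}^a − x_{m₄}^a = ((x_m/x_{m₂})^a − 1)·((x_m/x_{m₁})^a − 1)·((x_{m₁}·x_{m₂}/x_m)^a − x_{m₄}^a). -/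
theorem coprime_codivisors_of_lcm_eq {x y z p q : ℕ} (hx : 0 < x)
    (hp : x = y * p) (hq : x = z * q) (h : Nat.lcm y z = x) : Nat.Coprime p q := by
  obtain ⟨u, hu⟩ := Nat.gcd_dvd_left p q
  obtain ⟨v, hv⟩ := Nat.gcd_dvd_right p q
  set d := Nat.gcd p q with hd
  have hy : x = d * (y * u) := by
    rw [hp]; nth_rw 1 [hu]; ring
  have hz : x = d * (z * v) := by
    rw [hq]; nth_rw 1 [hv]; ring
  have hdpos : 0 < d := Nat.pos_of_ne_zero fun h0 => by simp [h0] at hy; omega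
  have huv : y * u = z * v := Nat.eq_of_mul_eq_mul_left hdpos (hy.symm.trans hz)
  have hdvd : x ∣ y * u := by
    rw [← h]
    exact Nat.lcm_dvd (dvd_mul_right y u) (huv ▸ dvd_mul_right z v)
  have hpos : 0 < y * u := Nat.pos_of_ne_zero fun h0 => by simp [h0] at hy; omega
  have hle := Nat.le_of_dvd hpos hdvd
  change d = 1
  nlinarith

theorem gcd_mul_right_of_coprime_left {p q : ℕ} (c : ℕ) (h : Nat.Coprime p q) :
    Nat.gcd (p * c) (q * c) = c := by
  rw [Nat.gcd_mul_right, h.gcd_eq_one, one_mul]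


open Finset

theorem alpha_factorization_int
    (S : Finset ℕ) (hpos : ∀ u ∈ S, 0 < u) (hgcd : gcdClosed S) (hG : condG S)
    (a : ℕ) (ha : 0 < a)
    (xm y₁ y₂ y₃ : ℕ) (hm : xm ∈ S)
    (hGTD : GTD S xm = {y₁, y₂, y₃}) (hcard : ({y₁, y₂, y₃} : Finset ℕ).card = 3) :
    y₁ ∣ xm ∧ y₂ ∣ xm ∧ xm ∣ y₁ * y₂ ∧
    (xm : ℤ) ^ a - (y₁ : ℤ) ^ a - (y₂ : ℤ) ^ a - (y₃ : ℤ) ^ a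
      + (Nat.gcd y₁ y₂ : ℤ) ^ a + (Nat.gcd y₁ y₃ : ℤ) ^ a + (Nat.gcd y₂ y₃ : ℤ) ^ a
      - (Nat.gcd (Nat.gcd y₁ y₂) y₃ : ℤ) ^ a =
    (((xm / y₂ : ℕ) : ℤ) ^ a - 1) * (((xm / y₁ : ℕ) : ℤ) ^ a - 1) *
      (((y₁ * y₂ / xm : ℕ) : ℤ) ^ a - (Nat.gcd (Nat.gcd y₁ y₂) y₃ : ℤ) ^ a) := by
  have hx := hpos xm hm
  have h₁ : y₁ ∈ GTD S xm := by simp [hGTD]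
  have h₂ : y₂ ∈ GTD S xm := by simp [hGTD]
  have h₃ : y₃ ∈ GTD S xm := by simp [hGTD]
  have h₁₂ : y₁ ≠ y₂ := by
    rintro rfl
    have := Finset.card_le_two (a := y₁) (b := y₃)
    simp_all
  have h₁₃ : y₁ ≠ y₃ := by
    rintro rfl
    have := Finset.card_le_two (a := y₂) (b := y₁)
    simp_all
  have h₂₃ : y₂ ≠ y₃ := by
    rintro rfl
    have := Finset.card_le_two (a := y₁) (b := y₂)
    simp_all
  obtain ⟨p, hp⟩ := (Finset.mem_filter.mp h₁).2.2.1
  obtain ⟨q, hq⟩ := (Finset.mem_filter.mp h₂).2.2.1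
  obtain ⟨r, hr⟩ := (Finset.mem_filter.mp h₃).2.2.1
  have hpq := coprime_codivisors_of_lcm_eq hx hp hq (hG xm hm y₁ h₁ y₂ h₂ h₁₂).1
  have hpr := coprime_codivisors_of_lcm_eq hx hp hr (hG xm hm y₁ h₁ y₃ h₃ h₁₃).1
  have hqr := coprime_codivisors_of_lcm_eq hx hq hr (hG xm hm y₂ h₂ y₃ h₃ h₂₃).1
  obtain ⟨k, hk⟩ : p * q * r ∣ xm :=
    (Nat.Coprime.mul_left hpr hqr).mul_dvd_of_dvd_of_dvd
      (hpq.mul_dvd_of_dvd_of_dvd (Dvd.intro_left _ hp.symm) (Dvd.intro_left _ hq.symm))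
      (Dvd.intro_left _ hr.symm)
  clear hGTD hcard h₁ h₂ h₃ h₁₂ h₁₃ h₂₃ hG hgcd hm
  have hpqrk : 0 < p * q * r * k := hk ▸ hx
  have hp0 : 0 < p := Nat.pos_of_ne_zero fun h => by simp [h] at hpqrk
  have hq0 : 0 < q := Nat.pos_of_ne_zero fun h => by simp [h] at hpqrk
  have hr0 : 0 < r := Nat.pos_of_ne_zero fun h => by simp [h] at hpqrk
  have hk0 : 0 < k := Nat.pos_of_ne_zero fun h => by simp [h] at hpqrk
  obtain rfl : y₁ = q * (r * k) :=
    Nat.eq_of_mul_eq_mul_right hp0 (by rw [← hp, hk]; ring)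
  obtain rfl : y₂ = p * (r * k) :=
    Nat.eq_of_mul_eq_mul_right hq0 (by rw [← hq, hk]; ring)
  obtain rfl : y₃ = p * (q * k) :=
    Nat.eq_of_mul_eq_mul_right hr0 (by rw [← hr, hk]; ring)
  have g₁₂ : Nat.gcd (q * (r * k)) (p * (r * k)) = r * k :=
    gcd_mul_right_of_coprime_left _ hpq.symm
  have g₁₃ : Nat.gcd (q * (r * k)) (p * (q * k)) = q * k := by
    rw [mul_left_comm q r k]
    exact gcd_mul_right_of_coprime_left _ hpr.symm
  have g₂₃ : Nat.gcd (p * (r * k)) (p * (q * k)) = p * k := by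
    rw [mul_left_comm p r k, mul_left_comm p q k]
    exact gcd_mul_right_of_coprime_left _ hqr.symm
  have g₁₂₃ : Nat.gcd (r * k) (p * (q * k)) = k := by
    rw [← mul_assoc p q k]
    exact gcd_mul_right_of_coprime_left _ (Nat.Coprime.mul_left hpr hqr).symm
  have hprod : q * (r * k) * (p * (r * k)) = xm * (r * k) := by rw [hk]; ring
  have d₂ : xm / (p * (r * k)) = q := Nat.div_eq_of_eq_mul_right (by positivity) hq
  have d₁ : xm / (q * (r * k)) = p := Nat.div_eq_of_eq_mul_right (by positivity) hp
  have d₁₂ : q * (r * k) * (p * (r * k)) / xm = r * k :=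
    Nat.div_eq_of_eq_mul_right hx hprod
  refine ⟨Dvd.intro _ hp.symm, Dvd.intro _ hq.symm, Dvd.intro _ hprod.symm, ?_⟩
  rw [g₁₂, g₁₃, g₂₃, g₁₂₃, d₁, d₂, d₁₂, hk]
  push_cast
  simp only [mul_pow]
  ring
end

section
/- Let a and b be positive integers with a ∣ b, let S be a gcd-closed set of distinct positive integers satisfying condition 𝒢, and let x_m ∈ S with G_S(x_m) = {x_{m₁}, x_{m₂}, x_{m₃}} consisting of exactly three elements; set x_{m_{ij}} := gcd(x_{m_i}, x_{m_j}) for 1 ≤ i < j ≤ 3 and x_{m₄} := gcd(x_{m₁}, x_{m₂}, x_{m₃}). Then for every x_t ∈ S with x_t ∣ x_m, the rational number (x_m^{b−a} − x_{m₁}^{b−a} − x_{m₂}^{b−a} − x_{m₃}^{b−a} + x_{m_{12}}^{b−a} + x_{m_{13}}^{b−a} + x_{m_{23}}^{b−a} − x_{m₄}^{b−a}) / (x_t^a·(x_m^{−a} − x_{m₁}^{−a} − x_{m₂}^{−a} − x_{m₃}^{−a} + x_{m_{12}}^{−a} + x_{m_{13}}^{−a} + x_{m_{23}}^{−a} − x_{m₄}^{−a}))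 is an integer. -/
open Finset

/-- If `y₁ * p = y₂ * q` is the least common multiple of `y₁` and `y₂`, the cofactors `p` and `q`
are coprime. -/
theorem coprime_cofactors_of_lcm_eq {x y₁ y₂ p q : ℕ} (hx : 0 < x) (h₁ : x = y₁ * p)
    (h₂ : x = y₂ * q) (h : Nat.lcm y₁ y₂ = x) : Nat.Coprime p q := by
  obtain ⟨p', hp⟩ := Nat.gcd_dvd_left p q
  obtain ⟨q', hq⟩ := Nat.gcd_dvd_right p q
  have hd : 0 < Nat.gcd p q := Nat.gcd_pos_of_pos_left _ (by
    rcases Nat.eq_zero_or_pos p with rfl | hp0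
    · simp [h₁] at hx
    · exact hp0)
  rw [Nat.Coprime]
  generalize Nat.gcd p q = d at *
  have e : y₁ * p' = y₂ * q' := by
    apply Nat.eq_of_mul_eq_mul_left hd
    calc d * (y₁ * p') = y₁ * (d * p') := by ring
      _ = y₂ * (d * q') := by rw [← hp, ← hq, ← h₁, h₂]
      _ = d * (y₂ * q') := by ring
  have hdvd : x ∣ y₁ * p' := h ▸ Nat.lcm_dvd (Dvd.intro _ rfl) (e ▸ Dvd.intro _ rfl)
  have hx' : x = d * (y₁ * p') := by rw [h₁, hp]; ring
  have hpos : 0 < y₁ * p' := Nat.pos_of_ne_zero fun h0 => by simp [hx', h0] at hx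
  have hle : d * (y₁ * p') ≤ 1 * (y₁ * p') := by
    rw [← hx', one_mul]
    exact Nat.le_of_dvd hpos hdvd
  exact le_antisymm (Nat.le_of_mul_le_mul_right hle hpos) hd

/-- Three divisors of `x` with pairwise least common multiple `x` have the form `w * q * r`,
`w * p * r`, `w * p * q` with `p`, `q`, `r` pairwise coprime and `x = w * p * q * r`. -/
theorem exists_coprime_factorization_of_lcm_eq {x y₁ y₂ y₃ : ℕ} (hx : 0 < x)
    (h₁₂ : Nat.lcm y₁ y₂ = x) (h₁₃ : Nat.lcm y₁ y₃ = x) (h₂₃ : Nat.lcm y₂ y₃ = x) :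
    ∃ w p q r : ℕ, Nat.Coprime p q ∧ Nat.Coprime p r ∧ Nat.Coprime q r ∧
      x = w * p * q * r ∧ y₁ = w * q * r ∧ y₂ = w * p * r ∧ y₃ = w * p * q := by
  obtain ⟨p, hp⟩ : y₁ ∣ x := h₁₂ ▸ Nat.dvd_lcm_left _ _
  obtain ⟨q, hq⟩ : y₂ ∣ x := h₁₂ ▸ Nat.dvd_lcm_right _ _
  obtain ⟨r, hr⟩ : y₃ ∣ x := h₁₃ ▸ Nat.dvd_lcm_right _ _
  have hpq := coprime_cofactors_of_lcm_eq hx hp hq h₁₂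
  have hpr := coprime_cofactors_of_lcm_eq hx hp hr h₁₃
  have hqr := coprime_cofactors_of_lcm_eq hx hq hr h₂₃
  obtain ⟨w, hw⟩ : p * q * r ∣ x :=
    (Nat.Coprime.mul_left hpr hqr).mul_dvd_of_dvd_of_dvd
      (hpq.mul_dvd_of_dvd_of_dvd (Dvd.intro_left _ hp.symm) (Dvd.intro_left _ hq.symm))
      (Dvd.intro_left _ hr.symm)
  have hp0 : 0 < p := Nat.pos_of_ne_zero fun h => by simp [hp, h] at hx
  have hq0 : 0 < q := Nat.pos_of_ne_zero fun h => by simp [hq, h] at hx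
  have hr0 : 0 < r := Nat.pos_of_ne_zero fun h => by simp [hr, h] at hx
  refine ⟨w, p, q, r, hpq, hpr, hqr, by rw [hw]; ring, ?_, ?_, ?_⟩
  · exact Nat.eq_of_mul_eq_mul_right hp0 (by rw [← hp, hw]; ring)
  · exact Nat.eq_of_mul_eq_mul_right hq0 (by rw [← hq, hw]; ring)
  · exact Nat.eq_of_mul_eq_mul_right hr0 (by rw [← hr, hw]; ring)

/-- `(p ^ k - 1) / (p ^ a - 1)` is an integer when `a ∣ k`. -/
theorem exists_int_pow_sub_one_eq {a k : ℕ} (h : a ∣ k) (p : ℕ) :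
    ∃ z : ℤ, (p : ℚ) ^ k - 1 = z * ((p : ℚ) ^ a - 1) := by
  obtain ⟨c, rfl⟩ := h
  obtain ⟨z, hz⟩ := sub_one_dvd_pow_sub_one ((p : ℤ) ^ a) c
  refine ⟨z, ?_⟩
  rw [← pow_mul] at hz
  have := congrArg (Int.cast : ℤ → ℚ) hz
  push_cast at this
  rw [this, mul_comm]

theorem alpha_quotient_is_integer
    (a b : ℕ) (ha : 0 < a) (hb : 0 < b) (hab : a ∣ b)
    (S : Finset ℕ) (hpos : ∀ u ∈ S, 0 < u) (hgcd : gcdClosed S) (hG : condG S)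
    (xm y₁ y₂ y₃ : ℕ) (hm : xm ∈ S)
    (hGTD : GTD S xm = {y₁, y₂, y₃}) (hcard : ({y₁, y₂, y₃} : Finset ℕ).card = 3)
    (xt : ℕ) (ht : xt ∈ S) (htd : xt ∣ xm) :
    ∃ z : ℤ,
      ((xm : ℚ) ^ (b - a) - (y₁ : ℚ) ^ (b - a) - (y₂ : ℚ) ^ (b - a) - (y₃ : ℚ) ^ (b - a)
        + (Nat.gcd y₁ y₂ : ℚ) ^ (b - a) + (Nat.gcd y₁ y₃ : ℚ) ^ (b - a)
        + (Nat.gcd y₂ y₃ : ℚ) ^ (b - a) - (Nat.gcd (Nat.gcd y₁ y₂) y₃ : ℚ) ^ (b - a)) /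
      ((xt : ℚ) ^ a *
        ((xm : ℚ) ^ (-(a : ℤ)) - (y₁ : ℚ) ^ (-(a : ℤ)) - (y₂ : ℚ) ^ (-(a : ℤ))
          - (y₃ : ℚ) ^ (-(a : ℤ)) + (Nat.gcd y₁ y₂ : ℚ) ^ (-(a : ℤ))
          + (Nat.gcd y₁ y₃ : ℚ) ^ (-(a : ℤ)) + (Nat.gcd y₂ y₃ : ℚ) ^ (-(a : ℤ))
          - (Nat.gcd (Nat.gcd y₁ y₂) y₃ : ℚ) ^ (-(a : ℤ)))) = (z : ℚ) := by
  have hx : 0 < xm := hpos xm hm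
  have hne : y₁ ≠ y₂ ∧ y₁ ≠ y₃ ∧ y₂ ≠ y₃ := by
    grind [Finset.card_le_two]
  have m₁ : y₁ ∈ GTD S xm := by simp [hGTD]
  have m₂ : y₂ ∈ GTD S xm := by simp [hGTD]
  have m₃ : y₃ ∈ GTD S xm := by simp [hGTD]
  have l₁ : y₁ < xm := (Finset.mem_filter.mp m₁).2.1
  have l₂ : y₂ < xm := (Finset.mem_filter.mp m₂).2.1
  have l₃ : y₃ < xm := (Finset.mem_filter.mp m₃).2.1
  obtain ⟨w, p, q, r, hpq, hpr, hqr, hxe, h₁, h₂, h₃⟩ :=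
    exists_coprime_factorization_of_lcm_eq hx (hG xm hm y₁ m₁ y₂ m₂ hne.1).1
      (hG xm hm y₁ m₁ y₃ m₃ hne.2.1).1 (hG xm hm y₂ m₂ y₃ m₃ hne.2.2).1
  have g₁₂ : Nat.gcd y₁ y₂ = w * r := by
    rw [h₁, h₂, mul_right_comm w q, mul_right_comm w p, Nat.gcd_mul_left, hpq.symm, mul_one]
  have g₁₃ : Nat.gcd y₁ y₃ = w * q := by
    rw [h₁, h₃, mul_right_comm w p, Nat.gcd_mul_left, hpr.symm, mul_one]
  have g₂₃ : Nat.gcd y₂ y₃ = w * p := by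
    rw [h₂, h₃, Nat.gcd_mul_left, hqr.symm, mul_one]
  have g : Nat.gcd (w * r) y₃ = w := by
    rw [h₃, mul_assoc, Nat.gcd_mul_left, (Nat.Coprime.mul_left hpr hqr).symm, mul_one]
  have hw0 : w ≠ 0 := by rintro rfl; simp [hxe] at hx
  have hp0 : p ≠ 0 := by rintro rfl; simp [hxe] at hx
  have hq0 : q ≠ 0 := by rintro rfl; simp [hxe] at hx
  have hr0 : r ≠ 0 := by rintro rfl; simp [hxe] at hx
  have hp1 : p ≠ 1 := by rintro rfl; simp [hxe, h₁] at l₁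
  have hq1 : q ≠ 1 := by rintro rfl; simp [hxe, h₂] at l₂
  have hr1 : r ≠ 1 := by rintro rfl; simp [hxe, h₃] at l₃
  have ne : ∀ n : ℕ, n ≠ 1 → (n : ℚ) ^ a - 1 ≠ 0 := fun n h1 h => by
    have : n ^ a = 1 := by exact_mod_cast sub_eq_zero.mp h
    exact h1 ((Nat.pow_eq_one.mp this).resolve_right ha.ne')
  have hk : a ∣ b - a := Nat.dvd_sub hab dvd_rfl
  obtain ⟨zp, hzp⟩ := exists_int_pow_sub_one_eq hk p
  obtain ⟨zq, hzq⟩ := exists_int_pow_sub_one_eq hk q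
  obtain ⟨zr, hzr⟩ := exists_int_pow_sub_one_eq hk r
  obtain ⟨c, hc⟩ := htd
  have ht0 : (xt : ℚ) ^ a ≠ 0 := pow_ne_zero _ (Nat.cast_ne_zero.mpr (hpos xt ht).ne')
  have hca : ((w : ℚ) * p * q * r) ^ a = (xt : ℚ) ^ a * (c : ℚ) ^ a := by
    rw [← mul_pow]
    exact_mod_cast congrArg (· ^ a) (hxe.symm.trans hc)
  refine ⟨-((w : ℤ) ^ (b - a) * (c : ℤ) ^ a * zp * zq * zr), ?_⟩
  rw [g₁₂, g₁₃, g₂₃, g, hxe, h₁, h₂, h₃]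
  generalize b - a = k at *
  have num : ((w * p * q * r : ℕ) : ℚ) ^ k - ((w * q * r : ℕ) : ℚ) ^ k
        - ((w * p * r : ℕ) : ℚ) ^ k - ((w * p * q : ℕ) : ℚ) ^ k + ((w * r : ℕ) : ℚ) ^ k
        + ((w * q : ℕ) : ℚ) ^ k + ((w * p : ℕ) : ℚ) ^ k - (w : ℚ) ^ k
      = (w : ℚ) ^ k * (((p : ℚ) ^ k - 1) * ((q : ℚ) ^ k - 1) * ((r : ℚ) ^ k - 1)) := by
    push_cast
    simp only [mul_pow]
    ring
  have wa := pow_ne_zero a (Nat.cast_ne_zero (R := ℚ).mpr hw0)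
  have pa := pow_ne_zero a (Nat.cast_ne_zero (R := ℚ).mpr hp0)
  have qa := pow_ne_zero a (Nat.cast_ne_zero (R := ℚ).mpr hq0)
  have ra := pow_ne_zero a (Nat.cast_ne_zero (R := ℚ).mpr hr0)
  have den : ((w * p * q * r : ℕ) : ℚ) ^ (-(a : ℤ)) - ((w * q * r : ℕ) : ℚ) ^ (-(a : ℤ))
        - ((w * p * r : ℕ) : ℚ) ^ (-(a : ℤ)) - ((w * p * q : ℕ) : ℚ) ^ (-(a : ℤ))
        + ((w * r : ℕ) : ℚ) ^ (-(a : ℤ)) + ((w * q : ℕ) : ℚ) ^ (-(a : ℤ))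
        + ((w * p : ℕ) : ℚ) ^ (-(a : ℤ)) - (w : ℚ) ^ (-(a : ℤ))
      = -(((p : ℚ) ^ a - 1) * ((q : ℚ) ^ a - 1) * ((r : ℚ) ^ a - 1))
          / ((w : ℚ) * p * q * r) ^ a := by
    push_cast
    simp only [zpow_neg, zpow_natCast, mul_pow]
    field_simp
    ring
  rw [num, den, hzp, hzq, hzr, hca]
  have hp2 := ne p hp1
  have hq2 := ne q hq1
  have hr2 := ne r hr1
  have hc0 : (c : ℚ) ^ a ≠ 0 := fun h => by
    rw [h, mul_zero] at hca
    simp only [mul_pow] at hca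
    exact mul_ne_zero (mul_ne_zero (mul_ne_zero wa pa) qa) ra hca
  push_cast
  generalize (p : ℚ) ^ a - 1 = P at *
  generalize (q : ℚ) ^ a - 1 = Q at *
  generalize (r : ℚ) ^ a - 1 = R at *
  field_simp
end

section
/- Let S be a gcd-closed set of distinct positive integers and let x_m ∈ S satisfy condition 𝒢 with G_S(x_m) = {x_{m₁}, x_{m₂}, x_{m₃}} consisting of exactly three elements; set x_{m_{ij}} := gcd(x_{m_i}, x_{m_j}) for 1 ≤ i < j ≤ 3 and x_{m₄} := gcd(x_{m₁}, x_{m₂}, x_{m₃}). Then x_{m₄} ≠ x_{m_{ij}} for all 1 ≤ i < j ≤ 3. -/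
open Finset

/-- If `lcm a c = lcm b c = x` and `gcd a b ∣ c` with `a` positive, then `c = x`. -/
lemma eq_of_lcm_eq_of_gcd_dvd {a b c x : ℕ} (ha : 0 < a) (hac : Nat.lcm a c = x)
    (hbc : Nat.lcm b c = x) (h : Nat.gcd a b ∣ c) : c = x := by
  have h₁ : x * Nat.gcd a c = c * a := by
    rw [← hac, mul_comm, Nat.gcd_mul_lcm, mul_comm]
  have h₂ : x * Nat.gcd b c = c * b := by
    rw [← hbc, mul_comm, Nat.gcd_mul_lcm, mul_comm]
  have hg : Nat.gcd (Nat.gcd a c) (Nat.gcd b c) = Nat.gcd a b := by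
    apply Nat.dvd_antisymm
    · exact Nat.dvd_gcd ((Nat.gcd_dvd_left _ _).trans (Nat.gcd_dvd_left _ _))
        ((Nat.gcd_dvd_right _ _).trans (Nat.gcd_dvd_left _ _))
    · exact Nat.dvd_gcd (Nat.dvd_gcd (Nat.gcd_dvd_left _ _) h)
        (Nat.dvd_gcd (Nat.gcd_dvd_right _ _) h)
  have h₃ : x * Nat.gcd a b = c * Nat.gcd a b := by
    rw [← hg, ← Nat.gcd_mul_left, h₁, h₂, Nat.gcd_mul_left, hg]
  exact (Nat.eq_of_mul_eq_mul_right (Nat.gcd_pos_of_pos_left b ha) h₃).symm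

/-- If `x` satisfies condition 𝒢, the gcd of two greatest-type divisors of `x` does not divide
a third one. -/
lemma condGAt.not_gcd_dvd {S : Finset ℕ} {x a b c : ℕ} (hpos : ∀ u ∈ S, 0 < u)
    (hG : condGAt S x) (ha : a ∈ GTD S x) (hb : b ∈ GTD S x) (hc : c ∈ GTD S x)
    (hac : a ≠ c) (hbc : b ≠ c) : ¬ Nat.gcd a b ∣ c := fun h =>
  (Finset.mem_filter.1 hc).2.1.ne <| eq_of_lcm_eq_of_gcd_dvd
    (hpos a (Finset.mem_filter.1 ha).1) (hG a ha c hc hac).1 (hG b hb c hc hbc).1 h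

theorem gcd_of_three_ne_pairwise_gcds
    (S : Finset ℕ) (hpos : ∀ u ∈ S, 0 < u) (hgcd : gcdClosed S)
    (xm y₁ y₂ y₃ : ℕ) (hm : xm ∈ S) (hGm : condGAt S xm)
    (hGTD : GTD S xm = {y₁, y₂, y₃}) (hcard : ({y₁, y₂, y₃} : Finset ℕ).card = 3) :
    Nat.gcd (Nat.gcd y₁ y₂) y₃ ≠ Nat.gcd y₁ y₂ ∧
    Nat.gcd (Nat.gcd y₁ y₂) y₃ ≠ Nat.gcd y₁ y₃ ∧
    Nat.gcd (Nat.gcd y₁ y₂) y₃ ≠ Nat.gcd y₂ y₃ := by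
  have m₁ : y₁ ∈ GTD S xm := by simp [hGTD]
  have m₂ : y₂ ∈ GTD S xm := by simp [hGTD]
  have m₃ : y₃ ∈ GTD S xm := by simp [hGTD]
  have h₁₂ : y₁ ≠ y₂ := by
    rintro rfl
    have := Finset.card_le_two (a := y₁) (b := y₃)
    simp at hcard
    omega
  have h₁₃ : y₁ ≠ y₃ := by
    rintro rfl
    have := Finset.card_le_two (a := y₂) (b := y₁)
    simp at hcard
    omega
  have h₂₃ : y₂ ≠ y₃ := by
    rintro rfl
    have := Finset.card_le_two (a := y₁) (b := y₂)
    simp at hcard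
    omega
  refine ⟨fun h => ?_, fun h => ?_, fun h => ?_⟩
  · exact hGm.not_gcd_dvd hpos m₁ m₂ m₃ h₁₃ h₂₃ (h ▸ Nat.gcd_dvd_right _ _)
  · exact hGm.not_gcd_dvd hpos m₁ m₃ m₂ h₁₂ h₂₃.symm
      (h ▸ (Nat.gcd_dvd_left _ _).trans (Nat.gcd_dvd_right _ _))
  · exact hGm.not_gcd_dvd hpos m₂ m₃ m₁ h₁₂.symm h₁₃.symm
      (h ▸ (Nat.gcd_dvd_left _ _).trans (Nat.gcd_dvd_left _ _))
end

section
/- Let S be a gcd-closed set of distinct positive integers satisfying condition 𝒢, and let x_l, x_m ∈ S with G_S(x_m) = {x_{m₁}, x_{m₂}, x_{m₃}} consisting of exactly three elements; set x_{m_{ij}} := gcd(x_{m_i}, x_{m_j}) for 1 ≤ i < j ≤ 3 and x_{m₄} := gcd(x_{m₁}, x_{m₂}, x_{m₃}). Suppose gcd(x_l, x_m) ∣ x_{m₁}, gcd(x_l, x_m) ≠ x_{m₁}, gcd(x_l, x_m) ∤ x_{m₂}, and gcd(x_l, x_m) ∤ x_{m₃}. Then gcd(x_l, x_{m₃}) =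 gcd(x_l, x_{m_{13}}), lcm(x_l, x_m) = lcm(x_l, x_{m₂}), lcm(x_l, x_{m₁}) = lcm(x_l, x_{m_{12}}), lcm(x_l, x_{m₃}) = lcm(x_l, x_{m_{23}}), and lcm(x_l, x_{m_{13}}) = lcm(x_l, x_{m₄}). -/
open Finset

/-- Divisibility on `ℕ` is distributive: a divisor `a` of `lcm l b` divides
`lcm l (gcd a b)`. -/
theorem dvd_lcm_gcd_of_dvd_lcm {a b l : ℕ} (h : a ∣ Nat.lcm l b) :
    a ∣ Nat.lcm l (Nat.gcd a b) := by
  rcases Nat.eq_zero_or_pos l with rfl | hl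
  · simp
  rcases Nat.eq_zero_or_pos b with rfl | hb
  · simpa using Nat.dvd_lcm_right l a
  have ha : a ≠ 0 := by
    rintro rfl
    exact Nat.lcm_ne_zero hl.ne' hb.ne' (Nat.eq_zero_of_zero_dvd h)
  have hg : Nat.gcd a b ≠ 0 := Nat.gcd_ne_zero_left ha
  rw [← Nat.factorization_le_iff_dvd ha (Nat.lcm_ne_zero hl.ne' hb.ne'),
    Nat.factorization_lcm hl.ne' hb.ne'] at h
  rw [← Nat.factorization_le_iff_dvd ha (Nat.lcm_ne_zero hl.ne' hg),
    Nat.factorization_lcm hl.ne' hg, Nat.factorization_gcd ha hb.ne']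
  intro p
  have hp := h p
  simp only [Finsupp.sup_apply, Finsupp.inf_apply] at hp ⊢
  grind

theorem lcm_eq_lcm_gcd_of_dvd_lcm {a b l : ℕ} (h : a ∣ Nat.lcm l b) :
    Nat.lcm l a = Nat.lcm l (Nat.gcd a b) :=
  Nat.dvd_antisymm (Nat.lcm_dvd (Nat.dvd_lcm_left _ _) (dvd_lcm_gcd_of_dvd_lcm h))
    (Nat.lcm_dvd (Nat.dvd_lcm_left _ _) ((Nat.gcd_dvd_left _ _).trans (Nat.dvd_lcm_right _ _)))

theorem mem_GTD {S : Finset ℕ} {x d : ℕ} :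
    d ∈ GTD S x ↔ d ∈ S ∧ d < x ∧ d ∣ x ∧ ∀ y ∈ S, d ∣ y → y ∣ x → y = d ∨ y = x := by
  simp [GTD]

/-- Every proper divisor in `S` of a positive `w` lies below a greatest-type divisor of `w`. -/
theorem exists_mem_GTD_of_dvd_s12 {S : Finset ℕ} {g w : ℕ} (hw : 0 < w) (hg : g ∈ S)
    (hgw : g ∣ w) (hne : g ≠ w) : ∃ z ∈ GTD S w, g ∣ z := by
  obtain ⟨z, hz, hmax⟩ := (S.filter fun z => g ∣ z ∧ z ∣ w ∧ z ≠ w).exists_max_image id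
    ⟨g, by simp [hg, hgw, hne]⟩
  simp only [Finset.mem_filter, id] at hz hmax
  obtain ⟨hzS, hgz, hzw, hzne⟩ := hz
  refine ⟨z, mem_GTD.2 ⟨hzS, lt_of_le_of_ne (Nat.le_of_dvd hw hzw) hzne, hzw, ?_⟩, hgz⟩
  intro y hy hzy hyw
  by_cases hyne : y = w
  · exact Or.inr hyne
  · exact Or.inl (le_antisymm (hmax y ⟨hy, hgz.trans hzy, hyw, hyne⟩)
      (Nat.le_of_dvd (Nat.pos_of_dvd_of_pos hyw hw) hzy))

/-- Under condition 𝒢, a divisor of `w` in `S` not dividing the greatest-type divisor `d` of `w`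
has least common multiple `w` with `d`. -/
theorem lcm_eq_of_mem_GTD_of_not_dvd {S : Finset ℕ} (hpos : ∀ u ∈ S, 0 < u) (hG : condG S)
    {g : ℕ} (hg : g ∈ S) {w d : ℕ} (hw : w ∈ S) (hgw : g ∣ w) (hd : d ∈ GTD S w)
    (hgd : ¬ g ∣ d) : Nat.lcm g d = w := by
  induction w using Nat.strong_induction_on generalizing d with
  | _ w ih =>
    have hdw : d ∣ w := (mem_GTD.1 hd).2.2.1
    by_cases hne : g = w
    · subst hne
      exact Nat.lcm_eq_left hdw
    · obtain ⟨z, hz, hgz⟩ := exists_mem_GTD_of_dvd_s12 (hpos w hw) hg hgw hne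
      have hzd : z ≠ d := by
        rintro rfl
        exact hgd hgz
      obtain ⟨hlcm, hgcd, -⟩ := hG w hw z hz d hd hzd
      obtain ⟨hzS, hzlt, -⟩ := mem_GTD.1 hz
      have key := ih z hzlt hzS hgz hgcd fun h => hgd (h.trans (Nat.gcd_dvd_right _ _))
      refine Nat.dvd_antisymm (Nat.lcm_dvd hgw hdw) ?_
      have hzl : z ∣ Nat.lcm g d := by
        rw [← key]
        exact Nat.lcm_dvd (Nat.dvd_lcm_left _ _)
          ((Nat.gcd_dvd_right _ _).trans (Nat.dvd_lcm_right _ _))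
      calc w = Nat.lcm z d := hlcm.symm
        _ ∣ Nat.lcm g d := Nat.lcm_dvd hzl (Nat.dvd_lcm_right _ _)

theorem gcd_lcm_identities_case3
    (S : Finset ℕ) (hpos : ∀ u ∈ S, 0 < u) (hgcd : gcdClosed S) (hG : condG S)
    (xl xm y₁ y₂ y₃ : ℕ) (hl : xl ∈ S) (hm : xm ∈ S)
    (hGTD : GTD S xm = {y₁, y₂, y₃}) (hcard : ({y₁, y₂, y₃} : Finset ℕ).card = 3)
    (h1 : Nat.gcd xl xm ∣ y₁) (h2 : Nat.gcd xl xm ≠ y₁)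
    (h3 : ¬ Nat.gcd xl xm ∣ y₂) (h4 : ¬ Nat.gcd xl xm ∣ y₃) :
    Nat.gcd xl y₃ = Nat.gcd xl (Nat.gcd y₁ y₃) ∧
    Nat.lcm xl xm = Nat.lcm xl y₂ ∧
    Nat.lcm xl y₁ = Nat.lcm xl (Nat.gcd y₁ y₂) ∧
    Nat.lcm xl y₃ = Nat.lcm xl (Nat.gcd y₂ y₃) ∧
    Nat.lcm xl (Nat.gcd y₁ y₃) = Nat.lcm xl (Nat.gcd (Nat.gcd y₁ y₂) y₃) := by
  have hy₁ : y₁ ∣ xm := (mem_GTD.1 (hGTD ▸ by simp : y₁ ∈ GTD S xm)).2.2.1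
  have hy₂ : y₂ ∈ GTD S xm := hGTD ▸ by simp
  have hy₃ : y₃ ∣ xm := (mem_GTD.1 (hGTD ▸ by simp : y₃ ∈ GTD S xm)).2.2.1
  have hlcm : Nat.lcm (Nat.gcd xl xm) y₂ = xm :=
    lcm_eq_of_mem_GTD_of_not_dvd hpos hG (hgcd xl hl xm hm) hm (Nat.gcd_dvd_right _ _) hy₂ h3
  have hxm : xm ∣ Nat.lcm xl y₂ := by
    rw [← hlcm]
    exact Nat.lcm_dvd (((Nat.gcd_dvd_left _ _)).trans (Nat.dvd_lcm_left _ _))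
      (Nat.dvd_lcm_right _ _)
  refine ⟨?_, ?_, lcm_eq_lcm_gcd_of_dvd_lcm (hy₁.trans hxm), ?_, ?_⟩
  · refine Nat.dvd_antisymm (Nat.dvd_gcd (Nat.gcd_dvd_left _ _) (Nat.dvd_gcd ?_
      (Nat.gcd_dvd_right _ _))) (Nat.gcd_dvd_gcd_of_dvd_right _ (Nat.gcd_dvd_right _ _))
    exact (Nat.gcd_dvd_gcd_of_dvd_right _ hy₃).trans h1
  · exact Nat.dvd_antisymm (Nat.lcm_dvd (Nat.dvd_lcm_left _ _) hxm)
      (Nat.lcm_dvd (Nat.dvd_lcm_left _ _)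
        ((mem_GTD.1 hy₂).2.2.1.trans (Nat.dvd_lcm_right _ _)))
  · rw [Nat.gcd_comm y₂ y₃]
    exact lcm_eq_lcm_gcd_of_dvd_lcm (hy₃.trans hxm)
  · rw [Nat.gcd_right_comm]
    exact lcm_eq_lcm_gcd_of_dvd_lcm ((Nat.gcd_dvd_left _ _).trans (hy₁.trans hxm))
end
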